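/- arXiv:2211.12693 — 3 statements merged into one kernel-verified Lean document; each statement's English description precedes it below -/
import Mathlib

section
/- Let K ⊂ ℝⁿ be a convex body with C^∞ boundary. Then there is a dense subset Σ ⊂ S^{n−1} such that for every ξ ∈ Σ the limit lim_{t → h_K⁺(ξ)⁻} A_K(ξ,t) / (h_K⁺(ξ) − t)^{(n−1)/2} exists and is a strictly positive real number c⁺(ξ); moreover for every ξ ∈ −Σ the limit lim_{t → h_K⁻(ξ)⁺} A_K(ξ,t) / (t − h_K⁻(ξ))^{(n−1)/2} exists and is strictly positive. -/
open MeasureTheory Real Filter Topology Metric Set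
open scoped RealInnerProductSpace

noncomputable section

/-- Euclidean space ℝⁿ. -/
abbrev En (n : ℕ) := EuclideanSpace ℝ (Fin n)

/-- A convex body: compact, convex, with nonempty interior. -/
def IsConvexBody {n : ℕ} (K : Set (En n)) : Prop :=
  IsCompact K ∧ Convex ℝ K ∧ (interior K).Nonempty

/-- `K` has C^∞ (infinitely smooth) boundary: near every boundary point, the boundary is the
zero set of a smooth local defining function with nonvanishing derivative. -/
def HasSmoothBoundary {n : ℕ} (K : Set (En n)) : Prop :=
  ∀ x ∈ frontier K, ∃ (U : Set (En n)) (f : En n → ℝ),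
    IsOpen U ∧ x ∈ U ∧ ContDiffOn ℝ (⊤ : ℕ∞) f U ∧
    (∀ y ∈ U, fderiv ℝ f y ≠ 0) ∧ (U ∩ frontier K = {y ∈ U | f y = 0})

/-- The sectional volume function `A_K(ξ,t)`: the (n-1)-dimensional Hausdorff measure of the
section of `K` by the hyperplane `{x : x·ξ = t}`. -/
def sectionVol {n : ℕ} (K : Set (En n)) (ξ : En n) (t : ℝ) : ℝ :=
  (μH[(n : ℝ) - 1] (K ∩ {x : En n | ⟪x, ξ⟫ = t})).toReal

/-- The support function `h_K⁺(ξ) = max_{x ∈ K} x·ξ`. -/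
def suppP {n : ℕ} (K : Set (En n)) (ξ : En n) : ℝ :=
  sSup ((fun x => ⟪x, ξ⟫) '' K)

/-- `h_K⁻(ξ) = min_{x ∈ K} x·ξ`. -/
def suppM {n : ℕ} (K : Set (En n)) (ξ : En n) : ℝ :=
  sInf ((fun x => ⟪x, ξ⟫) '' K)

/-- The open interval `I_ξ = (h_K⁻(ξ), h_K⁺(ξ))`. -/
def Iseg {n : ℕ} (K : Set (En n)) (ξ : En n) : Set ℝ :=
  Set.Ioo (suppM K ξ) (suppP K ξ)

/-- `HilbertAt f t L` : the Hilbert transform `(1/π) p.v. ∫ f(s)/(t-s) ds` of `f` at `t`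
exists (as a principal value) and equals `L`. -/
def HilbertAt (f : ℝ → ℝ) (t L : ℝ) : Prop :=
  Tendsto (fun ε : ℝ => (1 / π) * ∫ s in {s : ℝ | ε ≤ |t - s|}, f s / (t - s))
    (𝓝[>] (0 : ℝ)) (𝓝 L)

/-- An ellipsoid: the image of the closed unit ball under an invertible affine map. -/
def IsEllipsoid {n : ℕ} (K : Set (En n)) : Prop :=
  ∃ T : En n ≃ᵃ[ℝ] En n, K = T '' (Metric.closedBall (0 : En n) 1)

theorem IsPreconnected.subset_interior_of_disjoint_frontier {X : Type*} [TopologicalSpace X]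
    {s K : Set X} (hs : IsPreconnected s) (hd : ∀ y ∈ s, y ∉ frontier K) {y : X}
    (hys : y ∈ s) (hyK : y ∈ K) : s ⊆ interior K := by
  have key : ∀ z ∈ s, z ∈ closure K → z ∈ interior K := by
    intro z hz hzK
    by_contra h
    exact hd z hz ⟨hzK, h⟩
  refine hs.subset_of_closure_inter_subset isOpen_interior
    ⟨y, hys, key y hys (subset_closure hyK)⟩ ?_
  rintro z ⟨hz1, hz2⟩
  exact key z hz2 (closure_mono interior_subset hz1)

/-- A differentiable function vanishing at `x` is negative near `x` on the segments joining two
directions along which its derivative is negative. -/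
theorem HasFDerivAt.eventually_neg_on_segment {E : Type*} [NormedAddCommGroup E]
    [NormedSpace ℝ E] {f : E → ℝ} {x : E} {L : E →L[ℝ] ℝ} (hf : HasFDerivAt f L x)
    (hx : f x = 0) {v w : E} (hv : L v < 0) (hw : L w < 0) :
    ∀ᶠ ε in 𝓝[>] (0 : ℝ), ∀ u ∈ segment ℝ v w, f (x + ε • u) < 0 := by
  set m : ℝ := min (-L v) (-L w) with hm
  have hm0 : 0 < m := lt_min (by linarith) (by linarith)
  set M : ℝ := ‖v‖ + ‖w‖ + 1 with hM
  have hM0 : 0 < M := by positivity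
  have h1 := hf.isLittleO.bound (show 0 < m / (2 * M) by positivity)
  obtain ⟨r, hr, hball⟩ := Metric.eventually_nhds_iff.1 h1
  have h2 : ∀ᶠ ε in 𝓝[>] (0 : ℝ), ε < r / M :=
    (eventually_lt_nhds (by positivity)).filter_mono nhdsWithin_le_nhds
  filter_upwards [h2, self_mem_nhdsWithin] with ε hε1 hε0 u hu
  have hε0 : 0 < ε := hε0
  obtain ⟨a, b, ha, hb, hab, rfl⟩ := hu
  have hnorm : ‖a • v + b • w‖ ≤ M := by
    calc ‖a • v + b • w‖ ≤ ‖a • v‖ + ‖b • w‖ := norm_add_le _ _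
      _ = a * ‖v‖ + b * ‖w‖ := by
        rw [norm_smul, norm_smul, Real.norm_of_nonneg ha, Real.norm_of_nonneg hb]
      _ ≤ M := by nlinarith [norm_nonneg v, norm_nonneg w]
  have hLu : L (a • v + b • w) ≤ -m := by
    have e1 : m ≤ -L v := min_le_left _ _
    have e2 : m ≤ -L w := min_le_right _ _
    simp only [map_add, map_smul, smul_eq_mul]
    nlinarith
  set u := a • v + b • w
  have hεu : ‖ε • u‖ ≤ ε * M := by
    rw [norm_smul, Real.norm_of_nonneg hε0.le]
    gcongr
  have := hball (y := x + ε • u) (by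
    rw [dist_eq_norm, add_sub_cancel_left]
    exact hεu.trans_lt ((lt_div_iff₀ hM0).1 hε1))
  rw [hx, sub_zero, add_sub_cancel_left, map_smul, smul_eq_mul] at this
  have h3 := (le_abs_self _).trans this
  have h4 : m / (2 * M) * ‖ε • u‖ ≤ ε * m / 2 := by
    calc m / (2 * M) * ‖ε • u‖ ≤ m / (2 * M) * (ε * M) := by gcongr
      _ = ε * m / 2 := by field_simp
  nlinarith [mul_le_mul_of_nonneg_left hLu hε0.le, mul_pos hε0 hm0]

section LocalGeometry

variable {E : Type*} [NormedAddCommGroup E] [InnerProductSpace ℝ E]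

/-- If the zero set of `f` near `x` lies below the hyperplane through `x` orthogonal to `ξ`,
then the kernel of the derivative of `f` at `x` lies below that hyperplane as well. -/
theorem HasFDerivAt.inner_nonpos_of_zeros {f : E → ℝ} {x ξ : E} {L : E →L[ℝ] ℝ}
    (hf : HasFDerivAt f L x) (hx : f x = 0) (hcont : ∀ᶠ y in 𝓝 x, ContinuousAt f y)
    (hzero : ∀ᶠ y in 𝓝 x, f y = 0 → ⟪y - x, ξ⟫ ≤ 0) {u w : E} (hu : L u = 1)
    (hw : L w = 0) : ⟪w, ξ⟫ ≤ 0 := by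
  by_contra! hpos
  obtain ⟨δ, hδ, hδ'⟩ : ∃ δ : ℝ, 0 < δ ∧ δ * |⟪u, ξ⟫| < ⟪w, ξ⟫ := by
    refine ⟨⟪w, ξ⟫ / (|⟪u, ξ⟫| + 1), by positivity, ?_⟩
    rw [div_mul_eq_mul_div, div_lt_iff₀ (by positivity)]
    nlinarith [abs_nonneg ⟪u, ξ⟫]
  have hneg := hf.eventually_neg_on_segment hx (v := w - δ • u) (w := w - δ • u)
    (by simp [hu, hw, hδ]) (by simp [hu, hw, hδ])
  have hposi := hf.neg.eventually_neg_on_segment (by simp [hx]) (v := w + δ • u)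
    (w := w + δ • u) (by simp [hu, hw, hδ]) (by simp [hu, hw, hδ])
  obtain ⟨r, hr, hball⟩ := Metric.eventually_nhds_iff.1 (hcont.and hzero)
  set M : ℝ := ‖w‖ + δ * ‖u‖ + 1 with hM
  have hM0 : 0 < M := by positivity
  have hsmall : ∀ᶠ ε in 𝓝[>] (0 : ℝ), ε < r / M :=
    (eventually_lt_nhds (by positivity)).filter_mono nhdsWithin_le_nhds
  have hfalse : ∀ᶠ ε in 𝓝[>] (0 : ℝ), False := by
    filter_upwards [hneg, hposi, hsmall, self_mem_nhdsWithin] with ε h1 h2 h3 h4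
    have h4 : 0 < ε := h4
    have h1 := h1 _ (left_mem_segment ℝ _ _)
    have h2 := h2 _ (left_mem_segment ℝ _ _)
    have hin : ∀ θ ∈ Icc (-δ) δ, dist (x + ε • (w + θ • u)) x < r := by
      intro θ hθ
      rw [dist_eq_norm, add_sub_cancel_left, norm_smul, Real.norm_of_nonneg h4.le]
      have : ‖w + θ • u‖ ≤ M := by
        refine (norm_add_le _ _).trans ?_
        rw [norm_smul, Real.norm_eq_abs]
        have := abs_le.2 hθ
        nlinarith [norm_nonneg u]
      calc ε * ‖w + θ • u‖ ≤ ε * M := by gcongr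
        _ < r := (lt_div_iff₀ hM0).1 h3
    have hc : ContinuousOn (fun θ : ℝ => f (x + ε • (w + θ • u))) (Icc (-δ) δ) := by
      intro θ hθ
      have := (hball (hin θ hθ)).1
      exact (ContinuousAt.comp (f := fun θ : ℝ => x + ε • (w + θ • u)) this
        (by fun_prop)).continuousWithinAt
    obtain ⟨θ, hθ, hθ0⟩ := intermediate_value_Icc (by linarith) hc
      (show (0 : ℝ) ∈ Icc _ _ from ⟨by
        have : w + (-δ) • u = w - δ • u := by module
        simp only [this]; exact h1.le, by simpa using h2.le⟩)
    have := (hball (hin θ hθ)).2 hθ0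
    rw [add_sub_cancel_left, inner_smul_left, inner_add_left, inner_smul_left] at this
    simp only [conj_trivial] at this
    have h5 : |θ * ⟪u, ξ⟫| ≤ δ * |⟪u, ξ⟫| := by
      rw [abs_mul]
      exact mul_le_mul_of_nonneg_right (abs_le.2 hθ) (abs_nonneg _)
    have h6 := neg_abs_le (θ * ⟪u, ξ⟫)
    have : 0 < ε * (⟪w, ξ⟫ + θ * ⟪u, ξ⟫) := mul_pos h4 (by linarith)
    linarith
  exact hfalse.exists.elim fun _ h => h

/-- If the zero set of `f` near `x` lies below the hyperplane through `x` orthogonal to the unit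
vector `ξ`, then the derivative of `f` at `x` is a multiple of the inner product with `ξ`. -/
theorem HasFDerivAt.exists_eq_mul_inner {f : E → ℝ} {x ξ : E} {L : E →L[ℝ] ℝ}
    (hf : HasFDerivAt f L x) (hx : f x = 0) (hcont : ∀ᶠ y in 𝓝 x, ContinuousAt f y)
    (hzero : ∀ᶠ y in 𝓝 x, f y = 0 → ⟪y - x, ξ⟫ ≤ 0) (hL : L ≠ 0) (hξ : ‖ξ‖ = 1) :
    ∃ g : ℝ, g ≠ 0 ∧ ∀ v, L v = g * ⟪v, ξ⟫ := by
  obtain ⟨u, hu⟩ : ∃ u, L u = 1 := by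
    obtain ⟨u, hu⟩ := DFunLike.ne_iff.1 hL
    have hu : L u ≠ 0 := hu
    exact ⟨(L u)⁻¹ • u, by simp [hu]⟩
  have hker : ∀ w, L w = 0 → ⟪w, ξ⟫ = 0 := by
    intro w hw
    refine le_antisymm (hf.inner_nonpos_of_zeros hx hcont hzero hu hw) ?_
    have := hf.inner_nonpos_of_zeros hx hcont hzero hu (w := -w) (by simp [hw])
    rw [inner_neg_left] at this
    linarith
  have hall : ∀ v, ⟪v, ξ⟫ = L v * ⟪u, ξ⟫ := by
    intro v
    have := hker (v - L v • u) (by simp [hu])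
    rw [inner_sub_left, inner_smul_left] at this
    simpa [sub_eq_zero] using this
  have h1 : 1 = L ξ * ⟪u, ξ⟫ := by rw [← hall, real_inner_self_eq_norm_sq, hξ]; norm_num
  have hu0 : ⟪u, ξ⟫ ≠ 0 := by rintro h; simp [h] at h1
  refine ⟨⟪u, ξ⟫⁻¹, inv_ne_zero hu0, fun v => ?_⟩
  rw [hall v]
  field_simp

/-- A closed set with boundary `{f = 0}` near a support point `x` coincides with `{f ≤ 0}`
near `x` up to its boundary, when the gradient of `f` at `x` is the support direction `ξ`. -/
theorem eventually_mem_iff_neg {K U : Set E} {f : E → ℝ} {x ξ p : E} (hU : IsOpen U)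
    (hxU : x ∈ U) (hf : ContDiffOn ℝ 2 f U) (hx : f x = 0)
    (hfr : ∀ y ∈ U, y ∈ frontier K → f y = 0)
    (hL : ∀ v, fderiv ℝ f x v = ⟪v, ξ⟫) (hξ : ‖ξ‖ = 1)
    (hK : ∀ y ∈ K, ⟪y - x, ξ⟫ ≤ 0) (hpx : ⟪p - x, ξ⟫ < 0)
    (hseg : ∀ ε : ℝ, 0 < ε → ε ≤ 1 → x + ε • (p - x) ∈ K) :
    ∀ᶠ y in 𝓝 x, (f y < 0 → y ∈ K) ∧ (0 < f y → y ∉ K) := by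
  have hξξ : ⟪ξ, ξ⟫ = 1 := by rw [real_inner_self_eq_norm_sq, hξ]; norm_num
  have hdiff : ∀ y ∈ U, HasFDerivAt f (fderiv ℝ f y) y := fun y hy =>
    ((hf.contDiffAt (hU.mem_nhds hy)).differentiableAt (by norm_num)).hasFDerivAt
  have hcd : ContinuousAt (fun y => fderiv ℝ f y ξ) x := by
    have : ContinuousAt (fderiv ℝ f) x :=
      (hf.continuousOn_fderiv_of_isOpen hU (by norm_num)).continuousAt (hU.mem_nhds hxU)
    fun_prop
  have hpos : ∀ᶠ y in 𝓝 x, 0 < fderiv ℝ f y ξ :=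
    hcd.eventually (lt_mem_nhds (by simp only [hL, hξξ]; norm_num))
  obtain ⟨r, hr, hball⟩ := Metric.eventually_nhds_iff.1 (hpos.and (hU.mem_nhds hxU))
  obtain ⟨ρ, hρ, hρr⟩ : ∃ ρ : ℝ, 0 < ρ ∧ 2 * ρ = r := ⟨r / 2, by positivity, by ring⟩
  have hin : ∀ y, dist y x < ρ → ∀ τ ∈ Icc (-ρ) ρ, dist (y + τ • ξ) x < r := by
    intro y hy τ hτ
    calc dist (y + τ • ξ) x ≤ dist (y + τ • ξ) y + dist y x := dist_triangle _ _ _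
      _ = |τ| + dist y x := by
        rw [dist_eq_norm, add_sub_cancel_left, norm_smul, hξ, mul_one, Real.norm_eq_abs]
      _ < r := by have := abs_le.2 hτ; linarith
  have hmono : ∀ y, dist y x < ρ →
      StrictMonoOn (fun τ : ℝ => f (y + τ • ξ)) (Icc (-ρ) ρ) := by
    intro y hy
    have hd : ∀ τ ∈ Icc (-ρ) ρ,
        HasDerivAt (fun τ : ℝ => f (y + τ • ξ)) (fderiv ℝ f (y + τ • ξ) ξ) τ := by
      intro τ hτ
      have h1 : HasDerivAt (fun τ : ℝ => y + τ • ξ) ξ τ := by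
        simpa using ((hasDerivAt_id τ).smul_const ξ).const_add y
      exact (hdiff _ (hball (hin y hy τ hτ)).2).comp_hasDerivAt τ h1
    refine strictMonoOn_of_deriv_pos (convex_Icc _ _)
      (fun τ hτ => (hd τ hτ).continuousAt.continuousWithinAt) fun τ hτ => ?_
    have hτ := interior_subset hτ
    rw [(hd τ hτ).deriv]
    exact (hball (hin y hy τ hτ)).1
  have hline : ∀ y : E, ∀ a b : ℝ, IsPreconnected ((fun τ : ℝ => y + τ • ξ) '' Icc a b) :=
    fun y a b => isPreconnected_Icc.image _ (by fun_prop)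
  -- a point below `x` on the normal line lies in the interior
  obtain ⟨τ₀, hτ₀, hτρ, hτK⟩ : ∃ τ₀ : ℝ, 0 < τ₀ ∧ τ₀ < ρ ∧ x - τ₀ • ξ ∈ interior K := by
    have hn := (hdiff x hxU).eventually_neg_on_segment hx (v := p - x) (w := -ξ)
      (by rw [hL]; exact hpx) (by rw [hL, inner_neg_left, hξξ]; norm_num)
    have h2 : ∀ᶠ ε in 𝓝[>] (0 : ℝ), ε < min (min 1 ρ) (r / (‖p - x‖ + 2)) :=
      (eventually_lt_nhds (by positivity)).filter_mono nhdsWithin_le_nhds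
    obtain ⟨ε, ⟨hn, h2⟩, h0⟩ := ((hn.and h2).and self_mem_nhdsWithin).exists
    have h0 : 0 < ε := h0
    simp only [lt_min_iff] at h2
    refine ⟨ε, h0, h2.1.2, ?_⟩
    have hpre : IsPreconnected ((fun u : E => x + ε • u) '' segment ℝ (p - x) (-ξ)) :=
      (convex_segment _ _).isPreconnected.image _ (by fun_prop)
    have hsub := hpre.subset_interior_of_disjoint_frontier (K := K) ?_
      ⟨p - x, left_mem_segment ℝ _ _, rfl⟩ (hseg ε h0 h2.1.1.le)
    · have := hsub ⟨-ξ, right_mem_segment ℝ _ _, rfl⟩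
      simpa [sub_eq_add_neg] using this
    · rintro _ ⟨u, hu, rfl⟩ hfu
      refine (hn u hu).ne (hfr _ (hball ?_).2 hfu)
      rw [dist_eq_norm, add_sub_cancel_left, norm_smul, Real.norm_of_nonneg h0.le]
      have hu' : ‖u‖ ≤ ‖p - x‖ + 2 := by
        obtain ⟨a, b, ha, hb, hab, rfl⟩ := hu
        refine (norm_add_le _ _).trans ?_
        rw [norm_smul, norm_smul, norm_neg, hξ, Real.norm_of_nonneg ha, Real.norm_of_nonneg hb]
        nlinarith [norm_nonneg (p - x)]
      calc ε * ‖u‖ ≤ ε * (‖p - x‖ + 2) := by gcongr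
        _ < r := (lt_div_iff₀ (by positivity)).1 h2.2
  have hnear : ∀ᶠ y in 𝓝 x, y - τ₀ • ξ ∈ interior K := by
    have : ContinuousAt (fun y : E => y - τ₀ • ξ) x := by fun_prop
    exact this.eventually (isOpen_interior.mem_nhds hτK)
  filter_upwards [hnear, Metric.ball_mem_nhds x hρ] with y hy1 hy2
  have hy2 : dist y x < ρ := hy2
  have hm := hmono y hy2
  constructor
  · intro hneg
    have hsub := (hline y (-τ₀) 0).subset_interior_of_disjoint_frontier (K := K) ?_
      ⟨-τ₀, ⟨le_rfl, by linarith⟩, rfl⟩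
      (by simpa [sub_eq_add_neg] using interior_subset hy1)
    · exact interior_subset (hsub ⟨0, ⟨by linarith, le_rfl⟩, by simp⟩)
    · rintro _ ⟨τ, hτ, rfl⟩ hfu
      have hτ' : τ ∈ Icc (-ρ) ρ := ⟨by linarith [hτ.1], by linarith [hτ.2]⟩
      have h0 := hfr _ (hball (hin y hy2 τ hτ')).2 hfu
      have := hm.monotoneOn hτ' ⟨by linarith, by linarith⟩ hτ.2
      simp only [zero_smul, add_zero] at this
      linarith
  · intro hpos hyK
    have hsub := (hline y 0 ρ).subset_interior_of_disjoint_frontier (K := K) ?_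
      ⟨0, ⟨le_rfl, hρ.le⟩, by simp⟩ hyK
    · have h1 := hK _ (interior_subset (hsub ⟨ρ, ⟨hρ.le, le_rfl⟩, rfl⟩))
      simp only [add_sub_right_comm, inner_add_left, inner_smul_left, hξξ] at h1
      simp only [conj_trivial, mul_one] at h1
      have h2 := abs_real_inner_le_norm (y - x) ξ
      rw [hξ, mul_one, ← dist_eq_norm] at h2
      linarith [(abs_le.1 h2).1]
    · rintro _ ⟨τ, hτ, rfl⟩ hfu
      have hτ' : τ ∈ Icc (-ρ) ρ := ⟨by linarith [hτ.1], by linarith [hτ.2]⟩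
      have h0 := hfr _ (hball (hin y hy2 τ hτ')).2 hfu
      have := hm.monotoneOn ⟨by linarith, by linarith⟩ hτ' hτ.1
      simp only [zero_smul, add_zero] at this
      linarith

/-- Second order expansion along the parabola `r ↦ x + r z - r² ξ`. -/
theorem tendsto_div_sq_along_parabola {U : Set E} {f : E → ℝ} {x ξ z : E} (hU : IsOpen U)
    (hxU : x ∈ U) (hf : ContDiffOn ℝ 2 f U) (hx : f x = 0)
    (hL : ∀ v, fderiv ℝ f x v = ⟪v, ξ⟫) (hξ : ‖ξ‖ = 1) (hz : ⟪z, ξ⟫ = 0) :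
    Tendsto (fun r : ℝ => f (x + r • z - r ^ 2 • ξ) / r ^ 2) (𝓝[>] 0)
      (𝓝 (fderiv ℝ (fderiv ℝ f) x z z / 2 - 1)) := by
  have hξξ : ⟪ξ, ξ⟫ = 1 := by rw [real_inner_self_eq_norm_sq, hξ]; norm_num
  set γ : ℝ → E := fun r => x + r • z - r ^ 2 • ξ with hγ
  have hγ0 : γ 0 = x := by simp [hγ]
  have hdγ : ∀ r, HasDerivAt γ (z - (2 * r) • ξ) r := by
    intro r
    have h1 := ((hasDerivAt_id r).smul_const z).const_add x
    have h2 := (hasDerivAt_pow 2 r).smul_const ξ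
    simpa only [one_smul, Nat.cast_ofNat, Nat.add_one_sub_one, pow_one, id] using h1.fun_sub h2
  have hγc : Continuous γ := continuous_iff_continuousAt.2 fun r => (hdγ r).continuousAt
  have hγU : ∀ᶠ r in 𝓝 (0 : ℝ), γ r ∈ U :=
    hγc.continuousAt.eventually (by rw [hγ0]; exact hU.mem_nhds hxU)
  have hdf : ∀ᶠ r in 𝓝 (0 : ℝ),
      HasDerivAt (fun r => f (γ r)) (fderiv ℝ f (γ r) (z - (2 * r) • ξ)) r := by
    filter_upwards [hγU] with r hr
    exact ((hf.contDiffAt (hU.mem_nhds hr)).differentiableAt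
      (by norm_num)).hasFDerivAt.comp_hasDerivAt r (hdγ r)
  have hF : HasFDerivAt (fderiv ℝ f) (fderiv ℝ (fderiv ℝ f) x) x :=
    (((hf.contDiffAt (hU.mem_nhds hxU)).fderiv_right (m := 1)
      (by norm_num)).differentiableAt (by norm_num)).hasFDerivAt
  have hψ : HasDerivAt (fun r => fderiv ℝ f (γ r) (z - (2 * r) • ξ))
      (fderiv ℝ (fderiv ℝ f) x z z - 2) 0 := by
    have h1 : HasDerivAt (fun r => fderiv ℝ f (γ r)) (fderiv ℝ (fderiv ℝ f) x z) 0 := by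
      have := hdγ 0
      simp only [mul_zero, zero_smul, sub_zero] at this
      rw [← hγ0] at hF
      have := hF.comp_hasDerivAt (0 : ℝ) this
      rwa [hγ0] at this
    have h2 : HasDerivAt (fun r : ℝ => z - (2 * r) • ξ) (-((2 : ℝ) • ξ)) 0 := by
      simpa using (((hasDerivAt_id (0 : ℝ)).const_mul 2).smul_const ξ).const_sub z
    have := h1.clm_apply h2
    simpa [hγ0, hL, inner_smul_left, hξ, sub_eq_add_neg] using this
  have hψ0 : fderiv ℝ f (γ 0) (z - (2 * (0 : ℝ)) • ξ) = 0 := by simp [hγ0, hL, hz]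
  refine HasDerivAt.lhopital_zero_nhdsGT (hdf.filter_mono nhdsWithin_le_nhds)
    (g' := fun r => 2 * r) (Eventually.of_forall fun r => by simpa using hasDerivAt_pow 2 r)
    ?_ ?_ ?_ ?_
  · filter_upwards [self_mem_nhdsWithin] with r hr
    have hr : 0 < r := hr
    positivity
  · have := hdf.self_of_nhds.continuousAt.tendsto
    simp only [hγ0, hx] at this
    exact this.mono_left nhdsWithin_le_nhds
  · have : ContinuousAt (fun r : ℝ => r ^ 2) 0 := by fun_prop
    simpa using this.tendsto.mono_left nhdsWithin_le_nhds
  · have := (hψ.tendsto_slope.mono_left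
      (nhdsWithin_mono (0 : ℝ) (fun r (hr : 0 < r) => ne_of_gt hr))).div_const 2
    have e : (fderiv ℝ (fderiv ℝ f) x z z - 2) / 2 = fderiv ℝ (fderiv ℝ f) x z z / 2 - 1 := by
      ring
    rw [e] at this
    refine this.congr fun r => ?_
    rw [slope_def_field, hψ0, sub_zero, sub_zero, div_div, mul_comm r 2]

end LocalGeometry

/-- The level set of a quadratically homogeneous function is null for Haar measure, provided the
corresponding sublevel set has finite measure. -/
theorem measure_level_set_eq_zero {W : Type*} [NormedAddCommGroup W] [NormedSpace ℝ W]
    [FiniteDimensional ℝ W] [MeasurableSpace W] [BorelSpace W] (μ : Measure W)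
    [μ.IsAddHaarMeasure] {q : W → ℝ} (hq : Continuous q)
    (hhom : ∀ (r : ℝ) w, q (r • w) = r ^ 2 * q w) (hfin : μ {w | q w < 1} ≠ ⊤) :
    μ {w | q w = 1} = 0 := by
  have hle : μ {w | q w ≤ 1} ≤ μ {w | q w < 1} := by
    have hlim : Tendsto (fun r : ℝ => ENNReal.ofReal |r ^ Module.finrank ℝ W| *
        μ {w | q w < 1}) (𝓝[>] 1) (𝓝 (μ {w | q w < 1})) := by
      have h1 : ContinuousAt (fun r : ℝ => ENNReal.ofReal |r ^ Module.finrank ℝ W|) 1 :=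
        (ENNReal.continuous_ofReal.comp (by fun_prop)).continuousAt
      have h2 := ENNReal.Tendsto.mul_const (b := μ {w | q w < 1})
        (h1.tendsto.mono_left (nhdsWithin_le_nhds (s := Ioi 1))) (Or.inr hfin)
      simpa using h2
    refine ge_of_tendsto hlim ?_
    filter_upwards [self_mem_nhdsWithin] with r hr
    have hr : 1 < r := hr
    rw [← Measure.addHaar_smul]
    refine measure_mono fun w hw => ?_
    have hw : q w ≤ 1 := hw
    rw [Set.mem_smul_set_iff_inv_smul_mem₀ (by positivity)]
    change q (r⁻¹ • w) < 1
    rw [hhom, inv_pow, inv_mul_lt_iff₀ (by positivity)]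
    nlinarith
  have hsub : {w | q w < 1} ⊆ {w | q w ≤ 1} := fun w (hw : q w < 1) => hw.le
  have hdiff : {w | q w = 1} = {w | q w ≤ 1} \ {w | q w < 1} := by
    ext w
    simp only [mem_ofPred_eq, Set.mem_sdiff, not_lt]
    exact ⟨fun h => ⟨h.le, h.ge⟩, fun h => le_antisymm h.1 h.2⟩
  rw [hdiff, measure_sdiff hsub (isOpen_lt hq continuous_const).measurableSet.nullMeasurableSet
    hfin]
  exact tsub_eq_zero_of_le hle

section Ball

variable {E : Type*} [NormedAddCommGroup E] [InnerProductSpace ℝ E]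

theorem norm_sq_le_of_mem_closedBall {x y ξ : E} {R : ℝ} (hR : 0 ≤ R) (hξ : ‖ξ‖ = 1)
    (hy : y ∈ closedBall (x - R • ξ) R) : ‖y - x‖ ^ 2 ≤ -(2 * R * ⟪y - x, ξ⟫) := by
  rw [mem_closedBall, dist_eq_norm] at hy
  have h1 : y - (x - R • ξ) = (y - x) + R • ξ := by module
  have h2 := pow_le_pow_left₀ (norm_nonneg _) hy 2
  rw [h1, norm_add_sq_real, inner_smul_right, norm_smul, hξ, Real.norm_of_nonneg hR] at h2
  linarith

/-- Farthest points from distant centres: directions in which `K` is contained in a ball touching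
`K` are dense in the unit sphere. -/
theorem exists_enclosing_ball_near {K : Set E} (hK : IsCompact K) (hne : K.Nonempty) {ξ₀ : E}
    (hξ₀ : ‖ξ₀‖ = 1) {ε : ℝ} (hε : 0 < ε) :
    ∃ ξ : E, ‖ξ‖ = 1 ∧ dist ξ ξ₀ < ε ∧
      ∃ x ∈ K, ∃ R : ℝ, 0 < R ∧ K ⊆ closedBall (x - R • ξ) R := by
  obtain ⟨M, hM0, hM⟩ : ∃ M : ℝ, 0 < M ∧ ∀ y ∈ K, ‖y‖ ≤ M := by
    obtain ⟨M, hM⟩ := hK.isBounded.exists_norm_le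
    exact ⟨max M 1, by positivity, fun y hy => (hM y hy).trans (le_max_left _ _)⟩
  obtain ⟨δ, hδ, hδε, hδ1⟩ : ∃ δ : ℝ, 0 < δ ∧ 2 * (δ * M) < ε ∧ δ * M < 1 := by
    refine ⟨min ε 1 / (4 * M), by positivity, ?_, ?_⟩
    · have : min ε 1 / (4 * M) * M = min ε 1 / 4 := by field_simp
      rw [this]
      linarith [min_le_left ε 1]
    · have : min ε 1 / (4 * M) * M = min ε 1 / 4 := by field_simp
      rw [this]
      linarith [min_le_right ε 1]
  obtain ⟨x, hxK, hmax⟩ := hK.exists_isMaxOn hne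
    (f := fun y => dist y (-(δ⁻¹ • ξ₀))) (by fun_prop)
  set v : E := ξ₀ + δ • x with hv
  have hδx : ‖δ • x‖ ≤ δ * M := by
    rw [norm_smul, Real.norm_of_nonneg hδ.le]
    exact mul_le_mul_of_nonneg_left (hM x hxK) hδ.le
  have hvd : |‖v‖ - 1| ≤ δ * M := by
    rw [← hξ₀]
    refine (abs_norm_sub_norm_le v ξ₀).trans ?_
    rwa [hv, add_sub_cancel_left]
  have hv0 : 0 < ‖v‖ := by linarith [(abs_le.1 hvd).1]
  have hcenter : x - (δ⁻¹ * ‖v‖) • (‖v‖⁻¹ • v) = -(δ⁻¹ • ξ₀) := by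
    rw [smul_smul, mul_assoc, mul_inv_cancel₀ hv0.ne', mul_one, hv, smul_add, smul_smul,
      inv_mul_cancel₀ hδ.ne', one_smul]
    abel
  have hdist : dist x (-(δ⁻¹ • ξ₀)) = δ⁻¹ * ‖v‖ := by
    rw [← hcenter, dist_eq_norm, sub_sub_cancel, smul_smul, mul_assoc, mul_inv_cancel₀ hv0.ne',
      mul_one, norm_smul, Real.norm_of_nonneg (by positivity)]
  refine ⟨‖v‖⁻¹ • v, ?_, ?_, x, hxK, δ⁻¹ * ‖v‖, by positivity, fun y hy => ?_⟩
  · rw [norm_smul, norm_inv, norm_norm, inv_mul_cancel₀ hv0.ne']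
  · have h1 : dist (‖v‖⁻¹ • v) v = |‖v‖ - 1| := by
      have : ‖v‖⁻¹ • v - v = (‖v‖⁻¹ - 1) • v := by module
      rw [dist_eq_norm, this, norm_smul, Real.norm_eq_abs, ← abs_of_pos hv0, ← abs_mul,
        abs_of_pos hv0, sub_mul, inv_mul_cancel₀ hv0.ne', one_mul, abs_sub_comm]
    have h2 : dist v ξ₀ ≤ δ * M := by rwa [dist_eq_norm, hv, add_sub_cancel_left]
    linarith [dist_triangle (‖v‖⁻¹ • v) v ξ₀]
  · rw [hcenter, mem_closedBall, ← hdist]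
    exact hmax hy

end Ball

theorem suppP_eq_inner {n : ℕ} {K : Set (En n)} {x ξ : En n} (hx : x ∈ K)
    (h : ∀ y ∈ K, ⟪y - x, ξ⟫ ≤ 0) : suppP K ξ = ⟪x, ξ⟫ := by
  refine IsGreatest.csSup_eq ⟨⟨x, hx, rfl⟩, ?_⟩
  rintro _ ⟨y, hy, rfl⟩
  have := h y hy
  rw [inner_sub_left] at this
  simpa using this

theorem suppM_eq_neg_suppP_neg {n : ℕ} (K : Set (En n)) (ξ : En n) :
    suppM K ξ = -suppP K (-ξ) := by
  unfold suppM suppP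
  rw [← Real.sInf_neg, ← image_neg_eq_neg, image_image]
  simp

theorem sectionVol_neg {n : ℕ} (K : Set (En n)) (ξ : En n) (t : ℝ) :
    sectionVol K (-ξ) (-t) = sectionVol K ξ t := by
  simp [sectionVol]

/-- The section at depth `r²` below `x`, rescaled by `r⁻¹` and centred at `x - r² ξ`. -/
def rescaledSection {n : ℕ} (K : Set (En n)) (x ξ : En n) (r : ℝ) :
    Set (Submodule.span ℝ {ξ})ᗮ :=
  {w | x + r • (w : En n) - r ^ 2 • ξ ∈ K}

open scoped Pointwise in
theorem sectionVol_eq_rescaledSection {n : ℕ} (hn : 1 ≤ n) (K : Set (En n)) {x ξ : En n}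
    (hξ : ‖ξ‖ = 1) {r : ℝ} (hr : 0 < r) :
    sectionVol K ξ (⟪x, ξ⟫ - r ^ 2) =
      r ^ ((n : ℝ) - 1) * (μH[(n : ℝ) - 1] (rescaledSection K x ξ r)).toReal := by
  have hd : (0 : ℝ) ≤ (n : ℝ) - 1 := by
    have : (1 : ℝ) ≤ n := by exact_mod_cast hn
    linarith
  have hξξ : ⟪ξ, ξ⟫ = 1 := by rw [real_inner_self_eq_norm_sq, hξ]; norm_num
  have hset : K ∩ {y : En n | ⟪y, ξ⟫ = ⟪x, ξ⟫ - r ^ 2} =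
      (fun w : (Submodule.span ℝ {ξ})ᗮ => (x - r ^ 2 • ξ) + (w : En n)) ''
        (r • rescaledSection K x ξ r) := by
    ext y
    constructor
    · rintro ⟨hyK, hy⟩
      have hy : ⟪y, ξ⟫ = ⟪x, ξ⟫ - r ^ 2 := hy
      have hmem : y - (x - r ^ 2 • ξ) ∈ (Submodule.span ℝ {ξ})ᗮ := by
        rw [Submodule.mem_orthogonal_singleton_iff_inner_left, inner_sub_left, inner_sub_left,
          inner_smul_left, hξξ, hy]
        simp
      refine ⟨⟨_, hmem⟩, ?_, by simp⟩
      rw [Set.mem_smul_set_iff_inv_smul_mem₀ hr.ne']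
      change x + r • (r⁻¹ • (y - (x - r ^ 2 • ξ))) - r ^ 2 • ξ ∈ K
      rw [smul_smul, mul_inv_cancel₀ hr.ne', one_smul]
      convert hyK using 1
      abel
    · rintro ⟨_, ⟨w, hw, rfl⟩, rfl⟩
      have hw' : ⟪(w : En n), ξ⟫ = 0 :=
        (Submodule.mem_orthogonal_singleton_iff_inner_left).1 w.2
      constructor
      · have hw : x + r • (w : En n) - r ^ 2 • ξ ∈ K := hw
        convert hw using 1
        simp only [Submodule.coe_smul]
        abel
      · simp only [mem_ofPred_eq, Submodule.coe_smul, inner_add_left, inner_sub_left,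
          inner_smul_left, hw', hξξ]
        simp
  have hiso : Isometry (fun w : (Submodule.span ℝ {ξ})ᗮ => (x - r ^ 2 • ξ) + (w : En n)) :=
    (IsometryEquiv.addLeft (x - r ^ 2 • ξ)).isometry.comp isometry_subtype_coe
  rw [sectionVol, hset, hiso.hausdorffMeasure_image (Or.inl hd),
    Measure.hausdorffMeasure_smul₀ hd hr.ne', ENNReal.smul_def, smul_eq_mul, ENNReal.toReal_mul,
    ENNReal.coe_toReal, NNReal.coe_rpow, coe_nnnorm, Real.norm_of_nonneg hr.le]

/-- A smooth function cutting out `K` near a support point with normal `ξ`, normalised to have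
gradient `ξ` there. -/
theorem HasSmoothBoundary.exists_defining_function {n : ℕ} {K : Set (En n)}
    (hK : IsConvexBody K) (hsm : HasSmoothBoundary K) {x ξ : En n} (hxK : x ∈ K)
    (hξ : ‖ξ‖ = 1) {R : ℝ} (hR : 0 < R) (hball : K ⊆ closedBall (x - R • ξ) R) :
    ∃ (U : Set (En n)) (f : En n → ℝ), IsOpen U ∧ x ∈ U ∧ ContDiffOn ℝ 2 f U ∧ f x = 0 ∧
      (∀ v, fderiv ℝ f x v = ⟪v, ξ⟫) ∧
      ∀ᶠ y in 𝓝 x, (f y < 0 → y ∈ K) ∧ (0 < f y → y ∉ K) := by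
  have hξξ : ⟪ξ, ξ⟫ = 1 := by rw [real_inner_self_eq_norm_sq, hξ]; norm_num
  have hsq : ∀ y ∈ K, ‖y - x‖ ^ 2 ≤ -(2 * R * ⟪y - x, ξ⟫) := fun y hy =>
    norm_sq_le_of_mem_closedBall hR.le hξ (hball hy)
  have hle : ∀ y ∈ K, ⟪y - x, ξ⟫ ≤ 0 := by
    intro y hy
    by_contra! h
    nlinarith [hsq y hy, sq_nonneg ‖y - x‖, mul_pos hR h]
  have hxint : x ∉ interior K := by
    intro hx
    have hc : ContinuousAt (fun τ : ℝ => x + τ • ξ) 0 := by fun_prop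
    have h1 : ∀ᶠ τ in 𝓝 (0 : ℝ), x + τ • ξ ∈ interior K :=
      hc.eventually (isOpen_interior.mem_nhds (by simpa using hx))
    obtain ⟨τ, hτ, h0⟩ :=
      ((h1.filter_mono (nhdsWithin_le_nhds (s := Ioi 0))).and self_mem_nhdsWithin).exists
    have h0 : 0 < τ := h0
    have := hle _ (interior_subset hτ)
    rw [add_sub_cancel_left, inner_smul_left, hξξ] at this
    simp only [conj_trivial] at this
    linarith
  obtain ⟨hcomp, hconv, p, hp⟩ := hK
  have hpx : ⟪p - x, ξ⟫ < 0 := by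
    refine lt_of_le_of_ne (hle p (interior_subset hp)) fun h => ?_
    have h1 := hsq p (interior_subset hp)
    rw [h, mul_zero, neg_zero] at h1
    have h2 : ‖p - x‖ = 0 := by nlinarith [norm_nonneg (p - x)]
    rw [norm_eq_zero, sub_eq_zero] at h2
    exact hxint (h2 ▸ hp)
  obtain ⟨U, f, hU, hxU, hf, hf', hUf⟩ := hsm x ⟨subset_closure hxK, hxint⟩
  have hf2 : ContDiffOn ℝ 2 f U := hf.of_le
    (WithTop.coe_le_coe.2 (le_top : (2 : ℕ∞) ≤ ⊤))
  have hzero : ∀ y ∈ U, (y ∈ frontier K ↔ f y = 0) := by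
    intro y hy
    have := Set.ext_iff.1 hUf y
    simpa [hy] using this
  have hx0 : f x = 0 := (hzero x hxU).1 ⟨subset_closure hxK, hxint⟩
  have hfrK : ∀ y ∈ frontier K, y ∈ K := fun y hy => hcomp.isClosed.frontier_subset hy
  have hfd : HasFDerivAt f (fderiv ℝ f x) x :=
    ((hf2.contDiffAt (hU.mem_nhds hxU)).differentiableAt (by norm_num)).hasFDerivAt
  obtain ⟨g, hg, hgL⟩ := hfd.exists_eq_mul_inner hx0
    (by filter_upwards [hU.mem_nhds hxU] with y hy
        exact hf2.continuousOn.continuousAt (hU.mem_nhds hy))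
    (by filter_upwards [hU.mem_nhds hxU] with y hy h
        exact hle y (hfrK y ((hzero y hy).2 h)))
    (hf' x hxU) hξ
  have hF : ContDiffOn ℝ 2 (fun y => g⁻¹ * f y) U := contDiffOn_const.mul hf2
  have hFL : ∀ v, fderiv ℝ (fun y => g⁻¹ * f y) x v = ⟪v, ξ⟫ := by
    intro v
    rw [(hfd.const_mul g⁻¹).fderiv]
    simp [hgL, hg]
  refine ⟨U, fun y => g⁻¹ * f y, hU, hxU, hF, by simp [hx0], hFL, ?_⟩
  refine eventually_mem_iff_neg hU hxU hF (by simp [hx0])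
    (fun y hy hyf => by simp [(hzero y hy).1 hyf]) hFL hξ hle hpx fun ε h0 h1 => ?_
  exact hconv.add_smul_sub_mem hxK (interior_subset hp) ⟨h0.le, h1⟩

/-- If `K` lies in a ball touching it at `x`, the rescaled sections at `x` converge in measure. -/
theorem exists_tendsto_measure_rescaledSection {n : ℕ} {K : Set (En n)} (hK : IsConvexBody K)
    (hsm : HasSmoothBoundary K) {x ξ : En n} (hxK : x ∈ K) (hξ : ‖ξ‖ = 1) {R : ℝ}
    (hR : 0 < R) (hball : K ⊆ closedBall (x - R • ξ) R)
    (μ : Measure (Submodule.span ℝ {ξ})ᗮ) [μ.IsAddHaarMeasure] :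
    ∃ c : ℝ, 0 < c ∧
      Tendsto (fun r => (μ (rescaledSection K x ξ r)).toReal) (𝓝[>] 0) (𝓝 c) := by
  obtain ⟨U, f, hU, hxU, hf, hx0, hL, hside⟩ :=
    hsm.exists_defining_function hK hxK hξ hR hball
  have hξξ : ⟪ξ, ξ⟫ = 1 := by rw [real_inner_self_eq_norm_sq, hξ]; norm_num
  have horth : ∀ w : (Submodule.span ℝ {ξ})ᗮ, ⟪(w : En n), ξ⟫ = 0 := fun w =>
    (Submodule.mem_orthogonal_singleton_iff_inner_left).1 w.2
  have hcurve : ∀ w : En n, Tendsto (fun r : ℝ => x + r • w - r ^ 2 • ξ) (𝓝[>] 0) (𝓝 x) := by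
    intro w
    have : ContinuousAt (fun r : ℝ => x + r • w - r ^ 2 • ξ) 0 := by fun_prop
    simpa using this.tendsto.mono_left (nhdsWithin_le_nhds (s := Ioi 0))
  set q : (Submodule.span ℝ {ξ})ᗮ → ℝ := fun w =>
    fderiv ℝ (fderiv ℝ f) x (w : En n) (w : En n) / 2 with hq
  have hqc : Continuous q := by
    simp only [hq]
    fun_prop
  have hlim : ∀ w : (Submodule.span ℝ {ξ})ᗮ, Tendsto
      (fun r : ℝ => f (x + r • (w : En n) - r ^ 2 • ξ) / r ^ 2) (𝓝[>] 0) (𝓝 (q w - 1)) :=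
    fun w => tendsto_div_sq_along_parabola hU hxU hf hx0 hL hξ (horth w)
  have hin : ∀ w, q w < 1 → ∀ᶠ r in 𝓝[>] (0 : ℝ), w ∈ rescaledSection K x ξ r := by
    intro w hw
    filter_upwards [(hlim w).eventually (gt_mem_nhds (show q w - 1 < 0 by linarith)),
      (hcurve w).eventually hside, self_mem_nhdsWithin] with r h1 h2 h3
    have h3 : 0 < r := h3
    refine h2.1 ?_
    rwa [div_lt_iff₀ (by positivity), zero_mul] at h1
  have hout : ∀ w, 1 < q w → ∀ᶠ r in 𝓝[>] (0 : ℝ), w ∉ rescaledSection K x ξ r := by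
    intro w hw
    filter_upwards [(hlim w).eventually (lt_mem_nhds (show 0 < q w - 1 by linarith)),
      (hcurve w).eventually hside, self_mem_nhdsWithin] with r h1 h2 h3
    have h3 : 0 < r := h3
    refine h2.2 ?_
    rwa [lt_div_iff₀ (by positivity), zero_mul] at h1
  have hbdd : ∀ r : ℝ, 0 < r → rescaledSection K x ξ r ⊆ closedBall 0 (2 * R + 1) := by
    intro r hr w hw
    have h1 := norm_sq_le_of_mem_closedBall hR.le hξ (hball hw)
    have h2 : x + r • (w : En n) - r ^ 2 • ξ - x = r • (w : En n) - r ^ 2 • ξ := by abel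
    rw [h2, norm_sub_sq_real, inner_smul_left, inner_smul_right, horth, inner_sub_left,
      inner_smul_left, inner_smul_left, horth, hξξ, norm_smul, norm_smul, hξ,
      Real.norm_of_nonneg hr.le] at h1
    simp only [conj_trivial, mul_zero, sub_zero, zero_sub, mul_one] at h1
    rw [Real.norm_of_nonneg (by positivity)] at h1
    have h3 : r ^ 2 * ‖(w : En n)‖ ^ 2 ≤ r ^ 2 * (2 * R) := by nlinarith [sq_nonneg (r ^ 2)]
    have h4 := le_of_mul_le_mul_left h3 (by positivity)
    rw [mem_closedBall_zero_iff, Submodule.coe_norm]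
    nlinarith [norm_nonneg (w : En n)]
  have hA : {w | q w < 1} ⊆ closedBall 0 (2 * R + 1) := by
    intro w hw
    obtain ⟨r, h1, h2⟩ := ((hin w hw).and self_mem_nhdsWithin).exists
    exact hbdd r h2 h1
  have hBfin : μ (closedBall 0 (2 * R + 1)) ≠ ⊤ := measure_closedBall_lt_top.ne
  have hAfin : μ {w | q w < 1} ≠ ⊤ := ne_top_of_le_ne_top hBfin (measure_mono hA)
  have hAopen : IsOpen {w | q w < 1} := isOpen_lt hqc continuous_const
  have hnull : ∀ᵐ w ∂μ, q w ≠ 1 := by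
    rw [ae_iff]
    simpa using measure_level_set_eq_zero μ hqc (fun r w => by simp [hq]; ring) hAfin
  refine ⟨(μ {w | q w < 1}).toReal, ENNReal.toReal_pos
    (hAopen.measure_pos μ ⟨0, by simp [hq]⟩).ne' hAfin, ?_⟩
  refine (ENNReal.tendsto_toReal hAfin).comp ?_
  refine tendsto_measure_of_ae_tendsto_indicator _ hAopen.measurableSet (fun r => ?_)
    isClosed_closedBall.measurableSet hBfin ?_ ?_
  · exact (hK.1.isClosed.preimage (by fun_prop)).measurableSet
  · filter_upwards [self_mem_nhdsWithin] with r hr using hbdd r hr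
  · filter_upwards [hnull] with w hw
    rcases lt_or_gt_of_ne hw with h | h
    · filter_upwards [hin w h] with r hr using iff_of_true hr h
    · filter_upwards [hout w h] with r hr using iff_of_false hr h.not_gt

/-- If `K` lies in a ball touching it at `x` with outer normal `ξ`, its sectional volume decays
like `(h_K⁺(ξ) - t)^((n-1)/2)`. -/
theorem exists_tendsto_sectionVol_div {n : ℕ} {K : Set (En n)} (hK : IsConvexBody K)
    (hsm : HasSmoothBoundary K) {x ξ : En n} (hxK : x ∈ K) (hξ : ‖ξ‖ = 1) {R : ℝ}
    (hR : 0 < R) (hball : K ⊆ closedBall (x - R • ξ) R) :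
    ∃ c : ℝ, 0 < c ∧
      Tendsto (fun t : ℝ => sectionVol K ξ t / (suppP K ξ - t) ^ (((n : ℝ) - 1) / 2))
        (𝓝[<] (suppP K ξ)) (𝓝 c) := by
  have hξ0 : ξ ≠ 0 := by rintro rfl; simp at hξ
  have hrank : 1 + Module.finrank ℝ (Submodule.span ℝ {ξ})ᗮ = n := by
    have := (Submodule.span ℝ {ξ}).finrank_add_finrank_orthogonal
    rwa [finrank_span_singleton hξ0, finrank_euclideanSpace_fin] at this
  have hdim : (n : ℝ) - 1 = Module.finrank ℝ (Submodule.span ℝ {ξ})ᗮ := by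
    conv_lhs => rw [← hrank]
    push_cast
    ring
  have hhaar : (μH[(n : ℝ) - 1] : Measure (Submodule.span ℝ {ξ})ᗮ).IsAddHaarMeasure := by
    rw [hdim]
    infer_instance
  obtain ⟨c, hc, hlim⟩ := exists_tendsto_measure_rescaledSection hK hsm hxK hξ hR hball
    (μH[(n : ℝ) - 1] : Measure (Submodule.span ℝ {ξ})ᗮ)
  refine ⟨c, hc, ?_⟩
  have hsupp : suppP K ξ = ⟪x, ξ⟫ := suppP_eq_inner hxK fun y hy => by
    by_contra! h
    nlinarith [norm_sq_le_of_mem_closedBall hR.le hξ (hball hy), sq_nonneg ‖y - x‖,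
      mul_pos hR h]
  rw [hsupp]
  have hsqrt : Tendsto (fun t : ℝ => √(⟪x, ξ⟫ - t)) (𝓝[<] ⟪x, ξ⟫) (𝓝[>] 0) := by
    refine tendsto_nhdsWithin_iff.2 ⟨?_, ?_⟩
    · have : ContinuousAt (fun t : ℝ => √(⟪x, ξ⟫ - t)) ⟪x, ξ⟫ := by fun_prop
      simpa using this.tendsto.mono_left (nhdsWithin_le_nhds (s := Iio ⟪x, ξ⟫))
    · filter_upwards [self_mem_nhdsWithin] with t ht
      exact Real.sqrt_pos.2 (sub_pos.2 ht)
  refine (hlim.comp hsqrt).congr' ?_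
  filter_upwards [self_mem_nhdsWithin] with t ht
  have hpos : 0 < ⟪x, ξ⟫ - t := sub_pos.2 ht
  have h1 := sectionVol_eq_rescaledSection (by omega) K (x := x) hξ (Real.sqrt_pos.2 hpos)
  rw [Real.sq_sqrt hpos.le, sub_sub_cancel] at h1
  have h2 : √(⟪x, ξ⟫ - t) ^ ((n : ℝ) - 1) = (⟪x, ξ⟫ - t) ^ (((n : ℝ) - 1) / 2) := by
    rw [Real.sqrt_eq_rpow, ← Real.rpow_mul hpos.le]
    congr 1
    ring
  rw [h1, h2, Function.comp_apply, mul_div_cancel_left₀ _ (Real.rpow_pos_of_pos hpos _).ne']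

/-- Boundary asymptotics of the sectional volume function: on a dense set `Σ` of directions,
`A_K(ξ,t) ~ c⁺(ξ) (h_K⁺(ξ) - t)^((n-1)/2)` as `t → h_K⁺(ξ)⁻`, and the analogous expansion
holds at `h_K⁻(ξ)` for `ξ ∈ -Σ`. -/
theorem stmt5 (n : ℕ) (K : Set (En n)) (hK : IsConvexBody K) (hsm : HasSmoothBoundary K) :
    ∃ S : Set (En n), S ⊆ Metric.sphere (0 : En n) 1 ∧
      (∀ ξ ∈ Metric.sphere (0 : En n) 1, ξ ∈ closure S) ∧
      (∀ ξ ∈ S, ∃ c : ℝ, 0 < c ∧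
        Tendsto (fun t : ℝ => sectionVol K ξ t / (suppP K ξ - t) ^ (((n : ℝ) - 1) / 2))
          (𝓝[<] (suppP K ξ)) (𝓝 c)) ∧
      (∀ ξ : En n, -ξ ∈ S → ∃ c : ℝ, 0 < c ∧
        Tendsto (fun t : ℝ => sectionVol K ξ t / (t - suppM K ξ) ^ (((n : ℝ) - 1) / 2))
          (𝓝[>] (suppM K ξ)) (𝓝 c)) := by
  have hP : ∀ ξ ∈ {ξ : En n | ‖ξ‖ = 1 ∧ ∃ x ∈ K, ∃ R : ℝ, 0 < R ∧
      K ⊆ closedBall (x - R • ξ) R}, ∃ c : ℝ, 0 < c ∧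
        Tendsto (fun t : ℝ => sectionVol K ξ t / (suppP K ξ - t) ^ (((n : ℝ) - 1) / 2))
          (𝓝[<] (suppP K ξ)) (𝓝 c) := by
    rintro ξ ⟨hξ, x, hx, R, hR, hball⟩
    exact exists_tendsto_sectionVol_div hK hsm hx hξ hR hball
  refine ⟨_, fun ξ hξ => mem_sphere_zero_iff_norm.2 hξ.1, fun ξ hξ => ?_, hP, fun ξ hξ => ?_⟩
  · refine Metric.mem_closure_iff.2 fun ε hε => ?_
    obtain ⟨ζ, hζ, hd, hball⟩ := exists_enclosing_ball_near hK.1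
      (hK.2.2.mono interior_subset) (mem_sphere_zero_iff_norm.1 hξ) hε
    exact ⟨ζ, ⟨hζ, hball⟩, by rwa [dist_comm]⟩
  · obtain ⟨c, hc, hlim⟩ := hP _ hξ
    refine ⟨c, hc, ?_⟩
    rw [suppM_eq_neg_suppP_neg]
    have hneg : Tendsto (fun t : ℝ => -t) (𝓝[>] (-suppP K (-ξ))) (𝓝[<] (suppP K (-ξ))) := by
      simpa using tendsto_neg_nhdsGT_neg (a := suppP K (-ξ))
    refine (hlim.comp hneg).congr fun t => ?_
    rw [Function.comp_apply, sectionVol_neg]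
    congr 2
    ring

end
end

section
/- Let a < b be real numbers and let F : ℝ → ℝ be a continuous function supported in [a,b]. If there is a real polynomial P such that the Hilbert transform 𝓗F(t) = (1/π) p.v. ∫_a^b F(s)/(t−s) ds equals P(t) for all t ∈ (a,b), then there is a real polynomial Q such that √((b−t)(t−a)) · F(t) = Q(t) for all t ∈ (a,b). -/
open MeasureTheory Real Filter Topology Metric Set
open scoped RealInnerProductSpace

noncomputable section

/-- A bounded holomorphic function on the unit disc whose imaginary part has vanishing radial
limits almost everywhere is a real constant. -/
theorem eq_const_of_bounded_of_im_tendsto_zero {k : ℂ → ℂ} {C : ℝ}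
    (hk : DifferentiableOn ℂ k (ball 0 1))
    (hb : ∀ᵐ θ : ℝ, ∀ r ∈ Ioo (0 : ℝ) 1, ‖k (circleMap 0 r θ)‖ ≤ C)
    (h0 : ∀ᵐ θ : ℝ, Tendsto (fun r : ℝ => (k (circleMap 0 r θ)).im) (𝓝[<] 1) (𝓝 0))
    {w : ℂ} (hw : w ∈ ball (0 : ℂ) 1) : k w = (k 0).re := by
  set x : ℝ := (k 0).re with hx
  have hw1 : ‖w‖ < 1 := by simpa using hw
  have hev : ∀ᶠ r : ℝ in 𝓝[<] 1, r ∈ Ioo ‖w‖ 1 := Ioo_mem_nhdsLT hw1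
  have hcm : ∀ r ∈ Ioo (0 : ℝ) 1, ∀ θ, circleMap 0 r θ ∈ ball (0 : ℂ) 1 := by
    intro r hr θ
    simp [abs_of_pos hr.1, hr.2]
  have hcont : ∀ r ∈ Ioo (0 : ℝ) 1, Continuous fun θ => k (circleMap 0 r θ) := fun r hr =>
    hk.continuousOn.comp_continuous (continuous_circleMap 0 r) (hcm r hr)
  have hsq : DifferentiableOn ℂ (fun z => (k z - x) ^ 2) (ball 0 1) :=
    (hk.sub_const _).pow 2
  have hlim : Tendsto (fun r : ℝ => ∫ θ in (0 : ℝ)..2 * π, (k (circleMap 0 r θ)).im ^ 2)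
      (𝓝[<] 1) (𝓝 0) := by
    have := intervalIntegral.tendsto_integral_filter_of_dominated_convergence
      (μ := volume) (a := 0) (b := 2 * π) (l := 𝓝[<] (1 : ℝ))
      (F := fun r θ => (k (circleMap 0 r θ)).im ^ 2) (f := fun _ => (0 : ℝ)) (fun _ => C ^ 2)
      ?_ ?_ intervalIntegrable_const ?_
    · simpa using this
    · filter_upwards [hev] with r hr
      have := hcont r ⟨(norm_nonneg w).trans_lt hr.1, hr.2⟩
      exact ((Complex.continuous_im.comp this).pow 2).aestronglyMeasurable
    · filter_upwards [hev] with r hr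
      filter_upwards [hb] with θ hθ _
      rw [norm_pow]
      gcongr
      exact (Complex.abs_im_le_norm _).trans (hθ r ⟨(norm_nonneg w).trans_lt hr.1, hr.2⟩)
    · filter_upwards [h0] with θ hθ _
      simpa using hθ.pow 2
  have hle : ∀ r ∈ Ioo ‖w‖ 1, ‖k w - x‖ ^ 2 ≤
      (r / (r - ‖w‖)) *
        ((2 * π)⁻¹ * (2 * ∫ θ in (0 : ℝ)..2 * π, (k (circleMap 0 r θ)).im ^ 2)) := by
    intro r hr
    have hr0 : 0 < r := (norm_nonneg w).trans_lt hr.1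
    have hd : DiffContOnCl ℂ (fun z => (k z - x) ^ 2) (ball 0 |r|) := by
      rw [abs_of_pos hr0]
      refine (hsq.mono ?_).diffContOnCl
      rw [closure_ball _ hr0.ne']
      exact closedBall_subset_ball hr.2
    have hc := hcont r ⟨hr0, hr.2⟩
    have h1 := hd.circleAverage_smul_div (w := w) (by simpa [abs_of_pos hr0] using hr.1)
    have h2 := hd.circleAverage
    simp only [circleAverage_def, sub_zero, smul_eq_mul] at h1 h2
    have h3 : ∫ θ in (0 : ℝ)..2 * π, ‖k (circleMap 0 r θ) - x‖ ^ 2 ≤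
        2 * ∫ θ in (0 : ℝ)..2 * π, (k (circleMap 0 r θ)).im ^ 2 := by
      have e : ∀ θ, ‖k (circleMap 0 r θ) - x‖ ^ 2 = 2 * (k (circleMap 0 r θ)).im ^ 2 +
          ((k (circleMap 0 r θ) - x) ^ 2).re := by
        intro θ
        rw [← Complex.normSq_eq_norm_sq, Complex.normSq_apply]
        simp [pow_two]
        ring
      simp_rw [e]
      have hi1 : IntervalIntegrable (fun θ => 2 * (k (circleMap 0 r θ)).im ^ 2) volume 0 (2 * π) :=
        (((Complex.continuous_im.comp hc).pow 2).const_mul 2).intervalIntegrable _ _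
      have hi2 : Continuous (fun θ => (k (circleMap 0 r θ) - x) ^ 2) :=
        (hc.sub continuous_const).pow 2
      have hi3 : Continuous (fun θ => ((k (circleMap 0 r θ) - x) ^ 2).re) :=
        Complex.continuous_re.comp hi2
      have hre : ∫ θ in (0 : ℝ)..2 * π, ((k (circleMap 0 r θ) - x) ^ 2).re =
          (∫ θ in (0 : ℝ)..2 * π, (k (circleMap 0 r θ) - x) ^ 2).re :=
        Complex.reCLM.intervalIntegral_comp_comm (hi2.intervalIntegrable _ _)
      rw [intervalIntegral.integral_add hi1 (hi3.intervalIntegrable _ _),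
        intervalIntegral.integral_const_mul, hre]
      have h4 : (∫ θ in (0 : ℝ)..2 * π, (k (circleMap 0 r θ) - x) ^ 2) =
          ((2 * π : ℝ) : ℂ) * (k 0 - x) ^ 2 := by
        rw [← h2, Complex.real_smul, ← mul_assoc, ← Complex.ofReal_mul,
          mul_inv_cancel₀ (by positivity)]
        simp
      have h5 : ((k 0 - x) ^ 2).re = - (k 0).im ^ 2 := by
        simp [pow_two, hx]
      rw [h4, Complex.re_ofReal_mul, h5]
      have := mul_nonneg two_pi_pos.le (sq_nonneg (k 0).im)
      linarith
    rw [← norm_pow, ← h1, norm_smul, Real.norm_of_nonneg (by positivity)]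
    have h6 : ‖∫ θ in (0 : ℝ)..2 * π, circleMap 0 r θ / (circleMap 0 r θ - w) *
        (k (circleMap 0 r θ) - x) ^ 2‖ ≤ ∫ θ in (0 : ℝ)..2 * π, r / (r - ‖w‖) *
          ‖k (circleMap 0 r θ) - x‖ ^ 2 := by
      refine intervalIntegral.norm_integral_le_of_norm_le two_pi_pos.le (ae_of_all _ ?_)
        ((((hc.sub continuous_const).norm.pow 2).const_mul _).intervalIntegrable _ _)
      intro θ _
      have hn : ‖circleMap 0 r θ‖ = r := by simp [abs_of_pos hr0]
      rw [norm_mul, norm_pow, norm_div, hn]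
      have h7 : r - ‖w‖ ≤ ‖circleMap 0 r θ - w‖ := by
        have := norm_sub_norm_le (circleMap 0 r θ) w
        rwa [hn] at this
      have h8 := sub_pos.2 hr.1
      gcongr
    rw [intervalIntegral.integral_const_mul] at h6
    have h8 := sub_pos.2 hr.1
    calc _ ≤ (2 * π)⁻¹ * _ := mul_le_mul_of_nonneg_left h6 (by positivity)
      _ ≤ (2 * π)⁻¹ * (r / (r - ‖w‖) *
          (2 * ∫ θ in (0 : ℝ)..2 * π, (k (circleMap 0 r θ)).im ^ 2)) := by gcongr
      _ = _ := by ring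
  have hz : ‖k w - x‖ ^ 2 ≤ 0 := by
    have ht : Tendsto (fun r : ℝ => (r / (r - ‖w‖)) * ((2 * π)⁻¹ *
        (2 * ∫ θ in (0 : ℝ)..2 * π, (k (circleMap 0 r θ)).im ^ 2))) (𝓝[<] 1)
        (𝓝 ((1 / (1 - ‖w‖)) * ((2 * π)⁻¹ * (2 * 0)))) := by
      have hid : Tendsto (fun r : ℝ => r) (𝓝[<] 1) (𝓝 1) :=
        tendsto_nhdsWithin_of_tendsto_nhds tendsto_id
      refine Tendsto.mul (hid.div (hid.sub_const _) (sub_pos.2 hw1).ne') ?_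
      exact (hlim.const_mul 2).const_mul _
    simp only [mul_zero] at ht
    exact ge_of_tendsto ht (hev.mono hle)
  have : ‖k w - x‖ = 0 := by nlinarith [norm_nonneg (k w - x)]
  exact sub_eq_zero.1 (norm_eq_zero.1 this)

/-- The Poisson integral of a bounded function is bounded by the same constant. -/
theorem abs_im_integral_div_sub_le {F : ℝ → ℝ} (hF : Continuous F) (hc : HasCompactSupport F)
    {M : ℝ} (hM : ∀ s, |F s| ≤ M) {z : ℂ} (hz : z.im ≠ 0) :
    |(∫ s, (F s : ℂ) / (z - s)).im| ≤ M * π := by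
  have hne : ∀ s : ℝ, z - s ≠ 0 := fun s h => hz (by simpa using congrArg Complex.im h)
  have hint : Integrable (fun s : ℝ => (F s : ℂ) / (z - s)) := by
    refine Continuous.integrable_of_hasCompactSupport ?_ ?_
    · exact Continuous.div (by fun_prop) (by fun_prop) hne
    · simp_rw [div_eq_mul_inv]
      exact (hc.comp_left (g := fun x : ℝ => (x : ℂ)) (by simp)).mul_right
  have him : (∫ s, (F s : ℂ) / (z - s)).im = ∫ s, ((F s : ℂ) / (z - s)).im :=
    (Complex.imCLM.integral_comp_comm hint).symm
  have hP : ∫ s : ℝ, (1 + ((z.re - s) / z.im) ^ 2)⁻¹ = |z.im| * π := by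
    rw [integral_sub_left_eq_self (fun s : ℝ => (1 + (s / z.im) ^ 2)⁻¹) volume z.re,
      Measure.integral_comp_div (fun s : ℝ => (1 + s ^ 2)⁻¹), integral_univ_inv_one_add_sq,
      smul_eq_mul]
  have hPi : Integrable fun s : ℝ => (1 + ((z.re - s) / z.im) ^ 2)⁻¹ :=
    (integrable_inv_one_add_sq.comp_div hz).comp_sub_left z.re
  rw [him, ← Real.norm_eq_abs]
  calc _ ≤ ∫ s : ℝ, (M / |z.im|) * (1 + ((z.re - s) / z.im) ^ 2)⁻¹ := by
        refine norm_integral_le_of_norm_le (hPi.const_mul _) (ae_of_all _ fun s => ?_)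
        have e : ((F s : ℂ) / (z - s)).im =
            -(F s / z.im * (1 + ((z.re - s) / z.im) ^ 2)⁻¹) := by
          rw [Complex.div_im, Complex.normSq_apply]
          simp only [Complex.ofReal_im, Complex.ofReal_re, Complex.sub_re, Complex.sub_im]
          have : (z.re - s) * (z.re - s) + (z.im - 0) * (z.im - 0) ≠ 0 := by
            have := sq_pos_of_ne_zero hz
            nlinarith [sq_nonneg (z.re - s)]
          have h2 : 1 + ((z.re - s) / z.im) ^ 2 ≠ 0 := by positivity
          field_simp
          ring
        rw [e, norm_neg, norm_mul, Real.norm_eq_abs, Real.norm_eq_abs, abs_div,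
          abs_of_nonneg (a := (1 + ((z.re - s) / z.im) ^ 2)⁻¹) (by positivity)]
        gcongr
        exact hM s
    _ = M * π := by
        rw [integral_const_mul, hP]
        have := abs_ne_zero.2 hz
        field_simp

/-- The difference between a shifted Cauchy kernel at height one and the kernel `1 / u`
truncated at distance one. -/
def kernelDiff (d u : ℝ) : ℂ :=
  1 / ((u : ℂ) + d + Complex.I) - if 1 ≤ |u| then 1 / (u : ℂ) else 0

theorem norm_kernelDiff_le {d : ℝ} (hd : |d| ≤ 1 / 2) (u : ℝ) :
    ‖kernelDiff d u‖ ≤ 8 * (1 + u ^ 2)⁻¹ := by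
  have him : ((u : ℂ) + d + Complex.I).im = 1 := by simp
  have hre : ((u : ℂ) + d + Complex.I).re = u + d := by simp
  have h1 : 1 ≤ ‖(u : ℂ) + d + Complex.I‖ := by
    have := Complex.abs_im_le_norm ((u : ℂ) + d + Complex.I)
    rwa [him, abs_one] at this
  have hne : (u : ℂ) + d + Complex.I ≠ 0 := norm_pos_iff.1 (by linarith)
  unfold kernelDiff
  split_ifs with h
  · have hu : (u : ℂ) ≠ 0 := by
      intro h0
      have : u = 0 := by exact_mod_cast h0
      rw [this, abs_zero] at h
      linarith
    have h2 : |u| / 2 ≤ ‖(u : ℂ) + d + Complex.I‖ := by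
      have := Complex.abs_re_le_norm ((u : ℂ) + d + Complex.I)
      rw [hre] at this
      have h3 := abs_sub_abs_le_abs_sub u (-d)
      rw [abs_neg, sub_neg_eq_add] at h3
      linarith
    have e : 1 / ((u : ℂ) + d + Complex.I) - 1 / (u : ℂ) =
        -(d + Complex.I) / (((u : ℂ) + d + Complex.I) * u) := by
      field_simp
      ring
    have h4 : ‖(d : ℂ) + Complex.I‖ ≤ 2 := by
      refine (norm_add_le _ _).trans ?_
      simp only [Complex.norm_real, Complex.norm_I, Real.norm_eq_abs]
      linarith
    rw [e, norm_div, norm_neg, norm_mul, Complex.norm_real, Real.norm_eq_abs]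
    have hu0 : 0 < |u| := by linarith
    calc _ ≤ 2 / (|u| / 2 * |u|) := by gcongr
      _ = 8 * (2 * |u| ^ 2)⁻¹ := by field_simp; norm_num
      _ ≤ _ := by
        gcongr
        rw [← sq_abs u]
        nlinarith
  · rw [sub_zero, norm_div, norm_one]
    have hu : u ^ 2 ≤ 1 := by
      rw [← sq_abs]
      nlinarith [abs_nonneg u, not_le.1 h]
    calc _ ≤ (1 : ℝ) := by rw [div_le_one (by linarith)]; exact h1
      _ = 8 * 8⁻¹ := by norm_num
      _ ≤ _ := by gcongr; linarith

theorem measurable_kernelDiff (d : ℝ) : Measurable (kernelDiff d) := by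
  unfold kernelDiff
  refine Measurable.sub (by fun_prop) (Measurable.ite ?_ (by fun_prop) measurable_const)
  exact measurableSet_le measurable_const (by fun_prop)

theorem integrable_kernelDiff {d : ℝ} (hd : |d| ≤ 1 / 2) : Integrable (kernelDiff d) :=
  (integrable_inv_one_add_sq.const_mul 8).mono' (measurable_kernelDiff d).aestronglyMeasurable
    (ae_of_all _ (norm_kernelDiff_le hd))

theorem integral_kernelDiff_zero : ∫ u, kernelDiff 0 u = -(π * Complex.I) := by
  have hint : Integrable (kernelDiff 0) := integrable_kernelDiff (by norm_num)
  apply Complex.ext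
  · have e : (∫ u, kernelDiff 0 u).re = ∫ u, (kernelDiff 0 u).re :=
      (Complex.reCLM.integral_comp_comm hint).symm
    have hodd : ∀ u, (kernelDiff 0 (-u)).re = -(kernelDiff 0 u).re := by
      intro u
      unfold kernelDiff
      split_ifs with h1 h2 h2
      · simp [Complex.normSq_apply]
        ring
      · simp_all
      · simp_all
      · simp [Complex.normSq_apply]
        ring
    have h2 := integral_neg_eq_self (fun u => (kernelDiff 0 u).re) volume
    simp_rw [hodd, integral_neg] at h2
    rw [e]
    simp
    linarith
  · have e : (∫ u, kernelDiff 0 u).im = ∫ u, (kernelDiff 0 u).im :=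
      (Complex.imCLM.integral_comp_comm hint).symm
    have him : ∀ u, (kernelDiff 0 u).im = -(1 + u ^ 2)⁻¹ := by
      intro u
      unfold kernelDiff
      split_ifs
      · simp [Complex.normSq_apply, Complex.inv_im]
        ring
      · simp [Complex.normSq_apply, Complex.inv_im]
        ring
    rw [e]
    simp_rw [him, integral_neg, integral_univ_inv_one_add_sq]
    simp

/-- Boundary values from above of a Cauchy integral, at a point where the principal value exists. -/
theorem tendsto_integral_div_sub {F : ℝ → ℝ} (hF : Continuous F) (hc : HasCompactSupport F)
    {t L : ℝ} (hL : Tendsto (fun ε : ℝ => ∫ s in {s : ℝ | ε ≤ |t - s|}, F s / (t - s))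
      (𝓝[>] (0 : ℝ)) (𝓝 L))
    {ι : Type*} {l : Filter ι} [l.IsCountablyGenerated] {δ y : ι → ℝ}
    (hy : Tendsto y l (𝓝[>] 0)) (hδ : Tendsto (fun i => δ i / y i) l (𝓝 0)) :
    Tendsto (fun i => ∫ s, (F s : ℂ) / (((t + δ i : ℝ) : ℂ) + (y i : ℝ) * Complex.I - s)) l
      (𝓝 (L - π * F t * Complex.I)) := by
  obtain ⟨M, hM⟩ := hF.bounded_above_of_compact_support hc
  have hy0 : Tendsto y l (𝓝 0) := hy.mono_right nhdsWithin_le_nhds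
  have hypos : ∀ᶠ i in l, 0 < y i := hy.eventually self_mem_nhdsWithin
  have hd : ∀ᶠ i in l, |δ i / y i| ≤ 1 / 2 := by
    have := hδ.abs
    rw [abs_zero] at this
    exact this.eventually (ge_mem_nhds (by norm_num))
  have h1 : Tendsto (fun i => ∫ u, (F (t - y i * u) : ℂ) * kernelDiff (δ i / y i) u) l
      (𝓝 (∫ u, (F t : ℂ) * kernelDiff 0 u)) := by
    refine tendsto_integral_filter_of_dominated_convergence
      (fun u => M * (8 * (1 + u ^ 2)⁻¹)) ?_ ?_
      ((integrable_inv_one_add_sq.const_mul 8).const_mul M) ?_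
    · refine Eventually.of_forall fun i => ?_
      exact ((Continuous.measurable (by fun_prop)).mul
        (measurable_kernelDiff _)).aestronglyMeasurable
    · filter_upwards [hd] with i hi
      refine ae_of_all _ fun u => ?_
      rw [norm_mul, Complex.norm_real]
      have := hM (t - y i * u)
      have h2 := norm_kernelDiff_le hi u
      have h3 := (norm_nonneg _).trans this
      gcongr
    · refine ae_of_all _ fun u => Tendsto.mul ?_ ?_
      · have : Tendsto (fun i => F (t - y i * u)) l (𝓝 (F (t - 0 * u))) :=
          (hF.tendsto _).comp ((hy0.mul_const u).const_sub t)
        rw [zero_mul, sub_zero] at this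
        exact (Complex.continuous_ofReal.tendsto _).comp this
      · unfold kernelDiff
        refine Tendsto.sub_const ?_ _
        refine Tendsto.div tendsto_const_nhds ?_ ?_
        · exact (((Complex.continuous_ofReal.tendsto _).comp hδ).const_add (u : ℂ)).add_const _
        · intro h
          simpa using congrArg Complex.im h
  rw [integral_const_mul, integral_kernelDiff_zero] at h1
  have h2 : Tendsto (fun i => ((∫ s in {s : ℝ | y i ≤ |t - s|}, F s / (t - s) : ℝ) : ℂ)) l
      (𝓝 (L : ℂ)) := (Complex.continuous_ofReal.tendsto _).comp (hL.comp hy)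
  have h3 := h1.add h2
  have e : (F t : ℂ) * -(π * Complex.I) + L = L - π * F t * Complex.I := by ring
  rw [e] at h3
  refine h3.congr' ?_
  filter_upwards [hypos] with i hi
  have hms : MeasurableSet {s : ℝ | y i ≤ |t - s|} :=
    measurableSet_le measurable_const (by fun_prop)
  have hFi : Integrable F := hF.integrable_of_hasCompactSupport hc
  have hi1 : Integrable fun s : ℝ =>
      (F s : ℂ) / (((t + δ i : ℝ) : ℂ) + (y i : ℝ) * Complex.I - s) := by
    refine Continuous.integrable_of_hasCompactSupport ?_ ?_
    · refine Continuous.div (by fun_prop) (by fun_prop) fun s h => hi.ne' ?_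
      simpa using congrArg Complex.im h
    · simp_rw [div_eq_mul_inv]
      exact (hc.comp_left (g := fun x : ℝ => (x : ℂ)) (by simp)).mul_right
  have hi2 : Integrable ({s : ℝ | y i ≤ |t - s|}.indicator fun s => F s / (t - s)) := by
    refine (hFi.norm.mul_const (y i)⁻¹).mono' ?_ (ae_of_all _ fun s => ?_)
    · exact (Measurable.indicator (by fun_prop) hms).aestronglyMeasurable
    · by_cases hs : s ∈ {s : ℝ | y i ≤ |t - s|}
      · rw [indicator_of_mem hs, norm_div, div_eq_mul_inv]
        gcongr
        exact hs
      · rw [indicator_of_notMem hs, norm_zero]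
        positivity
  have hi3 : Integrable fun s : ℝ =>
      (({s : ℝ | y i ≤ |t - s|}.indicator (fun s => F s / (t - s)) s : ℝ) : ℂ) := hi2.ofReal
  rw [← integral_indicator hms, ← integral_complex_ofReal, ← eq_sub_iff_add_eq,
    ← integral_sub hi1 hi3]
  have hscale : ∀ f : ℝ → ℂ, ∫ s, f s = ∫ u, y i • f (t - y i * u) := by
    intro f
    rw [integral_smul, Measure.integral_comp_mul_left (fun u => f (t - u)),
      abs_of_pos (inv_pos.2 hi), smul_inv_smul₀ hi.ne', integral_sub_left_eq_self f volume t]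
  refine Eq.trans ?_ (hscale _).symm
  refine integral_congr_ae (ae_of_all _ fun u => ?_)
  have hyc : (y i : ℂ) ≠ 0 := by exact_mod_cast hi.ne'
  have hmem : t - y i * u ∈ {s : ℝ | y i ≤ |t - s|} ↔ 1 ≤ |u| := by
    simp only [mem_ofPred_eq, sub_sub_cancel, abs_mul, abs_of_pos hi]
    exact le_mul_iff_one_le_right hi
  have hden : ((t + δ i : ℝ) : ℂ) + (y i : ℝ) * Complex.I - (t - y i * u : ℝ) =
      y i * (u + (δ i / y i : ℝ) + Complex.I) := by
    push_cast
    field_simp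
    ring
  have hne : (u : ℂ) + (δ i / y i : ℝ) + Complex.I ≠ 0 := fun h => by
    simpa using congrArg Complex.im h
  simp only [kernelDiff, Set.indicator_apply, hmem, hden, Complex.real_smul]
  split_ifs with hu
  · have hu0 : (u : ℂ) ≠ 0 := by
      intro h0
      have : u = 0 := by exact_mod_cast h0
      rw [this, abs_zero] at hu
      linarith
    have : (t : ℂ) - (t - y i * u) = y i * u := by ring
    push_cast at hne ⊢
    rw [this]
    field_simp
  · push_cast at hne ⊢
    field_simp
    ring

/-- A real polynomial in `cos θ` is the real part on the unit circle of a real polynomial. -/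
theorem exists_polynomial_re_eq (P : Polynomial ℝ) :
    ∃ A : Polynomial ℝ, ∀ θ : ℝ,
      (A.aeval (Complex.exp (θ * Complex.I))).re = P.eval (Real.cos θ) := by
  have hX : ∀ P : Polynomial ℝ, (∃ A : Polynomial ℝ, ∀ θ : ℝ,
      (A.aeval (Complex.exp (θ * Complex.I))).re = P.eval (Real.cos θ)) →
      ∃ A : Polynomial ℝ, ∀ θ : ℝ,
        (A.aeval (Complex.exp (θ * Complex.I))).re = (P * Polynomial.X).eval (Real.cos θ) := by
    rintro P ⟨A, hA⟩
    refine ⟨Polynomial.C (1 / 2) * (Polynomial.X * A + A.divX +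
      Polynomial.C (A.coeff 0) * Polynomial.X), fun θ => ?_⟩
    rw [Polynomial.eval_mul, ← hA, Polynomial.eval_X]
    have h := Polynomial.divX_mul_X_add A
    set B := A.divX
    set c := A.coeff 0
    rw [← h]
    have hw : Complex.exp (θ * Complex.I) = Real.cos θ + Real.sin θ * Complex.I := by
      rw [Complex.exp_mul_I]
      simp
    rw [hw]
    simp only [map_mul, map_add, Polynomial.aeval_X, Polynomial.aeval_C]
    generalize Polynomial.aeval ((Real.cos θ : ℂ) + Real.sin θ * Complex.I) B = z
    simp [-Complex.ofReal_cos, -Complex.ofReal_sin]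
    linear_combination (-z.re / 2) * Real.sin_sq_add_cos_sq θ
  induction P using Polynomial.induction_on with
  | C a => exact ⟨Polynomial.C a, fun θ => by simp⟩
  | add p q hp hq =>
    obtain ⟨A, hA⟩ := hp
    obtain ⟨B, hB⟩ := hq
    exact ⟨A + B, fun θ => by simp [hA, hB]⟩
  | monomial n a ih =>
    rw [pow_succ, ← mul_assoc]
    exact hX _ ih

/-- The imaginary part of a real polynomial on the unit circle is `sin θ` times a polynomial
in `cos θ`. -/
theorem exists_polynomial_im_eq (A : Polynomial ℝ) :
    ∃ B : Polynomial ℝ, ∀ θ : ℝ,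
      (A.aeval (Complex.exp (θ * Complex.I))).im = B.eval (Real.cos θ) * Real.sin θ := by
  induction A using Polynomial.induction_on' with
  | add p q hp hq =>
    obtain ⟨A, hA⟩ := hp
    obtain ⟨B, hB⟩ := hq
    exact ⟨A + B, fun θ => by simp [hA, hB, add_mul]⟩
  | monomial n a =>
    refine ⟨Polynomial.C a * Polynomial.Chebyshev.U ℝ (n - 1), fun θ => ?_⟩
    rw [Polynomial.eval_mul, Polynomial.eval_C, mul_assoc, Polynomial.Chebyshev.U_real_cos,
      Polynomial.aeval_monomial, ← Complex.exp_nat_mul, ← mul_assoc,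
      show (n : ℂ) * θ = ((n * θ : ℝ) : ℂ) by push_cast; ring]
    simp only [Complex.coe_algebraMap, Complex.im_ofReal_mul, Complex.exp_ofReal_mul_I_im]
    push_cast
    ring_nf

/-- Differentiation under an integral over a compact set, for a continuous holomorphic family. -/
theorem differentiableOn_setIntegral_of_continuousOn {U : Set ℂ} (hU : IsOpen U) {S : Set ℝ}
    (hS : IsCompact S) {f f' : ℂ → ℝ → ℂ} (hf : ContinuousOn (Function.uncurry f) (U ×ˢ S))
    (hf' : ContinuousOn (Function.uncurry f') (U ×ˢ S))
    (hd : ∀ w ∈ U, ∀ s ∈ S, HasDerivAt (fun w => f w s) (f' w s) w) :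
    DifferentiableOn ℂ (fun w => ∫ s in S, f w s) U := by
  intro w hw
  obtain ⟨ε, hε, hsub⟩ := Metric.nhds_basis_closedBall.mem_iff.1 (hU.mem_nhds hw)
  obtain ⟨C, hC⟩ := ((isCompact_closedBall w ε).prod hS).exists_bound_of_continuousOn
    (hf'.mono (prod_mono hsub Subset.rfl))
  have hslice : ∀ {h : ℂ → ℝ → ℂ}, ContinuousOn (Function.uncurry h) (U ×ˢ S) →
      ∀ v ∈ U, ContinuousOn (h v) S := fun hh v hv =>
    hh.comp (f := fun s : ℝ => (v, s)) (by fun_prop) fun s hs => ⟨hv, hs⟩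
  refine ((hasDerivAt_integral_of_dominated_loc_of_deriv_le (F := f) (F' := f')
    (bound := fun _ => C) (Metric.closedBall_mem_nhds w hε) ?_ ?_ ?_ ?_ ?_
    ?_).2.differentiableAt).differentiableWithinAt
  · filter_upwards [hU.mem_nhds hw] with v hv
    exact (hslice hf v hv).aestronglyMeasurable hS.measurableSet
  · exact (hslice hf w hw).integrableOn_compact hS
  · exact (hslice hf' w hw).aestronglyMeasurable hS.measurableSet
  · exact (ae_restrict_iff' hS.measurableSet).2 (ae_of_all _ fun s hs v hv => hC (v, s) ⟨hv, hs⟩)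
  · exact integrableOn_const hS.measure_lt_top.ne
  · exact (ae_restrict_iff' hS.measurableSet).2 (ae_of_all _ fun s hs v hv => hd v (hsub hv) s hs)

/-- The Cauchy integral of `F` over `[m - ρ, m + ρ]`, pulled back to the unit disc by the
Joukowski map `w ↦ m + (ρ / 2) (w + w⁻¹)`. -/
def joukowskiCauchy (F : ℝ → ℝ) (m ρ : ℝ) (w : ℂ) : ℂ :=
  ∫ s in Icc (m - ρ) (m + ρ), (F s : ℂ) * (w / (ρ / 2 * (w ^ 2 + 1) - (s - m) * w))

theorem joukowski_denom_ne_zero {m ρ s : ℝ} (hρ : 0 < ρ) (hs : s ∈ Icc (m - ρ) (m + ρ)) {w : ℂ}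
    (hw : ‖w‖ < 1) : (ρ / 2 * (w ^ 2 + 1) - (s - m) * w : ℂ) ≠ 0 := by
  have hc : Real.cos (Real.arccos ((s - m) / ρ)) = (s - m) / ρ := by
    refine Real.cos_arccos ?_ ?_
    · rw [le_div_iff₀ hρ]
      linarith [hs.1]
    · rw [div_le_one hρ]
      linarith [hs.2]
  set φ := Real.arccos ((s - m) / ρ)
  have hsm : (s : ℂ) - m = ρ * Complex.cos φ := by
    rw [← Complex.ofReal_cos, hc]
    push_cast
    have : (ρ : ℂ) ≠ 0 := by exact_mod_cast hρ.ne'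
    field_simp
  have hfac : (ρ / 2 * (w ^ 2 + 1) - (s - m) * w : ℂ) =
      ρ / 2 * ((w - Complex.exp (φ * Complex.I)) * (w - Complex.exp (-φ * Complex.I))) := by
    have he : Complex.exp (φ * Complex.I) * Complex.exp (-φ * Complex.I) = 1 := by
      rw [← Complex.exp_add]
      simp
    rw [hsm, Complex.cos]
    linear_combination (-(ρ : ℂ) / 2) * he
  have hne : ∀ x : ℝ, w - Complex.exp (x * Complex.I) ≠ 0 := by
    intro x h
    rw [sub_eq_zero.1 h, Complex.norm_exp_ofReal_mul_I] at hw
    exact lt_irrefl _ hw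
  rw [hfac]
  refine mul_ne_zero ?_ (mul_ne_zero (hne φ) ?_)
  · simpa using hρ.ne'
  · simpa using hne (-φ)

theorem differentiableOn_joukowskiCauchy {F : ℝ → ℝ} (hF : Continuous F) {m ρ : ℝ} (hρ : 0 < ρ) :
    DifferentiableOn ℂ (joukowskiCauchy F m ρ) (ball 0 1) := by
  have hne : ∀ p ∈ ball (0 : ℂ) 1 ×ˢ Icc (m - ρ) (m + ρ),
      (ρ / 2 * (p.1 ^ 2 + 1) - (p.2 - m) * p.1 : ℂ) ≠ 0 := fun p hp =>
    joukowski_denom_ne_zero hρ hp.2 (by simpa using hp.1)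
  refine differentiableOn_setIntegral_of_continuousOn isOpen_ball isCompact_Icc
    (f' := fun w s => (F s : ℂ) * ((1 * (ρ / 2 * (w ^ 2 + 1) - (s - m) * w) -
      w * (ρ / 2 * (2 * w) - (s - m))) / (ρ / 2 * (w ^ 2 + 1) - (s - m) * w) ^ 2)) ?_ ?_ ?_
  · refine ContinuousOn.mul (by fun_prop) (ContinuousOn.div (by fun_prop) (by fun_prop) hne)
  · refine ContinuousOn.mul (by fun_prop) (ContinuousOn.div (by fun_prop) (by fun_prop) ?_)
    exact fun p hp => pow_ne_zero 2 (hne p hp)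
  · intro w hw s hs
    refine HasDerivAt.const_mul _ ((hasDerivAt_id w).div ?_ (hne (w, s) ⟨hw, hs⟩))
    have h1 := (((hasDerivAt_pow 2 w).add_const 1).const_mul (ρ / 2 : ℂ)).fun_sub
      ((hasDerivAt_id w).const_mul ((s : ℂ) - m))
    simpa using h1

/-- Away from the origin, `joukowskiCauchy` is the Cauchy integral at the Joukowski image. -/
theorem joukowskiCauchy_eq {F : ℝ → ℝ} {m ρ : ℝ}
    (hsupp : Function.support F ⊆ Icc (m - ρ) (m + ρ)) {w : ℂ} (hw : w ≠ 0) :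
    joukowskiCauchy F m ρ w = ∫ s, (F s : ℂ) / (m + ρ / 2 * (w + w⁻¹) - s) := by
  unfold joukowskiCauchy
  rw [setIntegral_eq_integral_of_forall_compl_eq_zero]
  · refine integral_congr_ae (ae_of_all _ fun s => ?_)
    have e : (ρ / 2 * (w ^ 2 + 1) - (s - m) * w : ℂ) = w * (m + ρ / 2 * (w + w⁻¹) - s) := by
      field_simp
      ring
    simp only
    rw [e, ← div_div, div_self hw, mul_one_div]
  · intro s hs
    rw [Function.notMem_support.1 fun h => hs (hsupp h)]
    simp

theorem joukowskiCauchy_conj (F : ℝ → ℝ) (m ρ : ℝ) (w : ℂ) :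
    joukowskiCauchy F m ρ (starRingEnd ℂ w) = starRingEnd ℂ (joukowskiCauchy F m ρ w) := by
  unfold joukowskiCauchy
  rw [← integral_conj]
  simp [map_ofNat (starRingEnd ℂ) 2]

theorem joukowski_circleMap (m ρ r θ : ℝ) :
    (m + ρ / 2 * (circleMap 0 r θ + (circleMap 0 r θ)⁻¹) : ℂ) =
      ((m + ρ * Real.cos θ + ρ / 2 * (r + r⁻¹ - 2) * Real.cos θ : ℝ) : ℂ) +
        ((ρ / 2 * (r - r⁻¹) * Real.sin θ : ℝ) : ℂ) * Complex.I := by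
  rw [circleMap_zero, mul_inv, ← Complex.exp_neg, ← neg_mul, Complex.exp_mul_I, Complex.exp_mul_I,
    Complex.cos_neg, Complex.sin_neg]
  push_cast
  ring

theorem abs_im_joukowskiCauchy_le {F : ℝ → ℝ} (hF : Continuous F) {m ρ : ℝ} (hρ : 0 < ρ)
    (hsupp : Function.support F ⊆ Icc (m - ρ) (m + ρ)) {M : ℝ} (hM : ∀ s, |F s| ≤ M)
    {r θ : ℝ} (hr : r ∈ Ioo (0 : ℝ) 1) (hθ : Real.sin θ ≠ 0) :
    |(joukowskiCauchy F m ρ (circleMap 0 r θ)).im| ≤ M * π := by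
  have hc : HasCompactSupport F := HasCompactSupport.of_support_subset_isCompact isCompact_Icc hsupp
  rw [joukowskiCauchy_eq hsupp (circleMap_ne_center hr.1.ne')]
  refine abs_im_integral_div_sub_le hF hc hM ?_
  rw [joukowski_circleMap]
  have h1 : 1 < r⁻¹ := (one_lt_inv₀ hr.1).2 hr.2
  have h2 : r - r⁻¹ ≠ 0 := by linarith [hr.2]
  simp only [Complex.add_im, Complex.ofReal_im, Complex.im_ofReal_mul, Complex.I_im, mul_one,
    zero_add]
  exact mul_ne_zero (mul_ne_zero (by positivity) h2) hθ

/-- Radial boundary values of `joukowskiCauchy` on the lower half of the unit circle. -/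
theorem tendsto_joukowskiCauchy {F : ℝ → ℝ} (hF : Continuous F) {m ρ : ℝ} (hρ : 0 < ρ)
    (hsupp : Function.support F ⊆ Icc (m - ρ) (m + ρ)) {θ L : ℝ} (hθ : Real.sin θ < 0)
    (hL : HilbertAt F (m + ρ * Real.cos θ) L) :
    Tendsto (fun r : ℝ => joukowskiCauchy F m ρ (circleMap 0 r θ)) (𝓝[<] 1)
      (𝓝 ((π * L : ℝ) - π * F (m + ρ * Real.cos θ) * Complex.I)) := by
  have hc : HasCompactSupport F := HasCompactSupport.of_support_subset_isCompact isCompact_Icc hsupp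
  have hev : ∀ᶠ r : ℝ in 𝓝[<] 1, r ∈ Ioo (0 : ℝ) 1 := Ioo_mem_nhdsLT one_pos
  have hid : Tendsto (fun r : ℝ => r) (𝓝[<] 1) (𝓝 1) :=
    tendsto_nhdsWithin_of_tendsto_nhds tendsto_id
  have hpv : Tendsto (fun ε : ℝ => ∫ s in {s : ℝ | ε ≤ |m + ρ * Real.cos θ - s|},
      F s / (m + ρ * Real.cos θ - s)) (𝓝[>] (0 : ℝ)) (𝓝 (π * L)) := by
    refine (Tendsto.const_mul π hL).congr fun ε => ?_
    rw [← mul_assoc, mul_one_div_cancel pi_ne_zero, one_mul]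
  have h := tendsto_integral_div_sub hF hc hpv (l := 𝓝[<] (1 : ℝ))
    (δ := fun r => ρ / 2 * (r + r⁻¹ - 2) * Real.cos θ)
    (y := fun r => ρ / 2 * (r - r⁻¹) * Real.sin θ) ?_ ?_
  · refine h.congr' ?_
    filter_upwards [hev] with r hr
    rw [joukowskiCauchy_eq hsupp (circleMap_ne_center hr.1.ne'), joukowski_circleMap]
  · refine tendsto_nhdsWithin_iff.2 ⟨?_, ?_⟩
    · have := ((hid.sub (hid.inv₀ one_ne_zero)).const_mul (ρ / 2)).mul_const (Real.sin θ)
      simpa using this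
    · filter_upwards [hev] with r hr
      have h1 : 1 < r⁻¹ := (one_lt_inv₀ hr.1).2 hr.2
      exact mul_pos_of_neg_of_neg (mul_neg_of_pos_of_neg (by positivity) (by linarith [hr.2])) hθ
  · have h2 : Tendsto (fun r : ℝ => -((1 - r) / (1 + r)) * (Real.cos θ / Real.sin θ)) (𝓝[<] 1)
        (𝓝 (-((1 - 1) / (1 + 1)) * (Real.cos θ / Real.sin θ))) :=
      (((hid.const_sub 1).div (hid.const_add 1) (by norm_num)).neg).mul_const _
    simp only [sub_self, zero_div, neg_zero, zero_mul] at h2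
    refine h2.congr' ?_
    filter_upwards [hev] with r hr
    have h3 : r ≠ 0 := hr.1.ne'
    have h4 : 1 + r ≠ 0 := by linarith [hr.1]
    have h5 : r ^ 2 - 1 ≠ 0 := by nlinarith [hr.1, hr.2]
    have e1 : r + r⁻¹ - 2 = (1 - r) ^ 2 / r := by field_simp; ring
    have e2 : r - r⁻¹ = (r ^ 2 - 1) / r := by field_simp
    have h6 := hθ.ne
    rw [e1, e2]
    field_simp
    ring

theorem ae_sin_ne_zero : ∀ᵐ θ : ℝ, Real.sin θ ≠ 0 := by
  have hc : {θ : ℝ | Real.sin θ = 0}.Countable := by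
    refine (countable_range fun n : ℤ => (n : ℝ) * π).mono fun θ hθ => ?_
    exact Real.sin_eq_zero_iff.1 hθ
  exact hc.ae_notMem volume

theorem tendsto_re_joukowskiCauchy {F : ℝ → ℝ} (hF : Continuous F) {m ρ : ℝ} (hρ : 0 < ρ)
    (hsupp : Function.support F ⊆ Icc (m - ρ) (m + ρ)) {θ L : ℝ} (hθ : Real.sin θ ≠ 0)
    (hL : HilbertAt F (m + ρ * Real.cos θ) L) :
    Tendsto (fun r : ℝ => (joukowskiCauchy F m ρ (circleMap 0 r θ)).re) (𝓝[<] 1)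
      (𝓝 (π * L)) := by
  rcases hθ.lt_or_gt with h | h
  · have := (Complex.continuous_re.tendsto _).comp (tendsto_joukowskiCauchy hF hρ hsupp h hL)
    simpa [Function.comp_def] using this
  · have h' : Real.sin (-θ) < 0 := by simpa using h
    rw [← Real.cos_neg] at hL
    have := (Complex.continuous_re.tendsto _).comp (tendsto_joukowskiCauchy hF hρ hsupp h' hL)
    have e : ∀ r : ℝ, circleMap 0 r (-θ) = starRingEnd ℂ (circleMap 0 r θ) := fun r => by
      simp [circleMap, ← Complex.exp_conj]
    simpa [Function.comp_def, e, joukowskiCauchy_conj] using this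

/-- If a holomorphic function on the unit disc has imaginary part bounded almost everywhere on
circles, and its real part has vanishing radial limits, then it is constant. -/
theorem eq_of_im_bounded_of_re_tendsto_zero {h : ℂ → ℂ} {C : ℝ}
    (hh : DifferentiableOn ℂ h (ball 0 1))
    (hb : ∀ᵐ θ : ℝ, ∀ r ∈ Ioo (0 : ℝ) 1, |(h (circleMap 0 r θ)).im| ≤ C)
    (h0 : ∀ᵐ θ : ℝ, Tendsto (fun r : ℝ => (h (circleMap 0 r θ)).re) (𝓝[<] 1) (𝓝 0))
    {w : ℂ} (hw : w ∈ ball (0 : ℂ) 1) : h w = h 0 := by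
  set k : ℂ → ℂ := fun w => Complex.exp (Complex.I * h w) with hk
  have hre : ∀ w, (Complex.I * h w).re = -(h w).im := fun w => by simp
  have him : ∀ w, (Complex.I * h w).im = (h w).re := fun w => by simp
  have hkd : DifferentiableOn ℂ k (ball 0 1) := (hh.const_mul _).cexp
  have hkb : ∀ᵐ θ : ℝ, ∀ r ∈ Ioo (0 : ℝ) 1, ‖k (circleMap 0 r θ)‖ ≤ Real.exp C := by
    filter_upwards [hb] with θ hθ r hr
    rw [hk, Complex.norm_exp, hre]
    exact Real.exp_le_exp.2 ((neg_le_abs _).trans (hθ r hr))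
  have hk0 : ∀ᵐ θ : ℝ, Tendsto (fun r : ℝ => (k (circleMap 0 r θ)).im) (𝓝[<] 1) (𝓝 0) := by
    filter_upwards [hb, h0] with θ hθ hθ0
    have hlim := hθ0.abs.const_mul (Real.exp C)
    rw [abs_zero, mul_zero] at hlim
    refine squeeze_zero_norm' ?_ hlim
    filter_upwards [Ioo_mem_nhdsLT one_pos] with r hr
    rw [hk, Complex.exp_im, hre, him, norm_mul, Real.norm_of_nonneg (Real.exp_pos _).le]
    gcongr
    · exact (neg_le_abs _).trans (hθ r hr)
    · exact Real.abs_sin_le_abs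
  have hconst : EqOn k (fun _ => ((k 0).re : ℂ)) (ball 0 1) := fun v hv =>
    eq_const_of_bounded_of_im_tendsto_zero hkd hkb hk0 hv
  have hder : EqOn (deriv h) 0 (ball 0 1) := by
    intro v hv
    have hhv := (hh.differentiableAt (isOpen_ball.mem_nhds hv)).hasDerivAt
    have h1 : HasDerivAt k _ v := (hhv.const_mul Complex.I).cexp
    have h2 := (hconst.eventuallyEq_of_mem (isOpen_ball.mem_nhds hv)).deriv_eq
    rw [h1.deriv, deriv_const] at h2
    simpa [Complex.exp_ne_zero, Complex.I_ne_zero] using h2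
  exact isOpen_ball.is_const_of_deriv_eq_zero (convex_ball (0 : ℂ) 1).isPreconnected hh hder hw
    (mem_ball_self one_pos)

/-- A continuous function supported in an interval, whose Hilbert transform is a polynomial inside,
is a polynomial times the square root weight of the interval. -/
theorem exists_polynomial_eq_sqrt_mul {F : ℝ → ℝ} (hF : Continuous F) {m ρ : ℝ} (hρ : 0 < ρ)
    (hsupp : Function.support F ⊆ Icc (m - ρ) (m + ρ)) {P : Polynomial ℝ}
    (hH : ∀ t ∈ Ioo (m - ρ) (m + ρ), HilbertAt F t (P.eval t)) :
    ∃ B : Polynomial ℝ, ∀ x ∈ Ioo (-1 : ℝ) 1, F (m + ρ * x) = √(1 - x ^ 2) * B.eval x := by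
  have hc : HasCompactSupport F := HasCompactSupport.of_support_subset_isCompact isCompact_Icc hsupp
  obtain ⟨M, hM⟩ := hF.bounded_above_of_compact_support hc
  obtain ⟨A, hA⟩ := exists_polynomial_re_eq
    (Polynomial.C π * P.comp (Polynomial.C m + Polynomial.C ρ * Polynomial.X))
  obtain ⟨B, hB⟩ := exists_polynomial_im_eq A
  have hAc : Continuous fun w : ℂ => A.aeval w := A.continuous_aeval
  obtain ⟨K, hK⟩ := (isCompact_closedBall (0 : ℂ) 1).exists_bound_of_continuousOn hAc.continuousOn
  have hmem : ∀ {θ : ℝ}, Real.sin θ ≠ 0 → m + ρ * Real.cos θ ∈ Ioo (m - ρ) (m + ρ) := by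
    intro θ hθ
    have h1 := Real.sin_sq_add_cos_sq θ
    have h2 := sq_pos_of_ne_zero hθ
    have h3 : |Real.cos θ| < 1 := by
      rw [← sq_lt_one_iff_abs_lt_one]
      linarith
    have h4 := abs_lt.1 h3
    constructor <;> nlinarith [h4.1, h4.2]
  have hAlim : ∀ θ : ℝ, Tendsto (fun r : ℝ => A.aeval (circleMap 0 r θ)) (𝓝[<] 1)
      (𝓝 (A.aeval (Complex.exp (θ * Complex.I)))) := by
    intro θ
    have : Continuous fun r : ℝ => A.aeval (circleMap 0 r θ) := by
      refine hAc.comp ?_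
      simp only [circleMap]
      fun_prop
    have h1 := (this.tendsto 1).mono_left (nhdsWithin_le_nhds (s := Iio 1))
    simpa [circleMap] using h1
  have hconst : ∀ w ∈ ball (0 : ℂ) 1, joukowskiCauchy F m ρ w - A.aeval w =
      joukowskiCauchy F m ρ 0 - A.aeval 0 := by
    intro w hw
    refine eq_of_im_bounded_of_re_tendsto_zero (h := fun w => joukowskiCauchy F m ρ w - A.aeval w)
      (C := M * π + K)
      ((differentiableOn_joukowskiCauchy hF hρ).sub A.differentiable_aeval.differentiableOn)
      ?_ ?_ hw
    · filter_upwards [ae_sin_ne_zero] with θ hθ r hr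
      rw [Complex.sub_im]
      refine (abs_sub _ _).trans (add_le_add
        (abs_im_joukowskiCauchy_le hF hρ hsupp hM hr hθ)
        ((Complex.abs_im_le_norm _).trans (hK _ ?_)))
      simp [abs_of_pos hr.1, hr.2.le]
    · filter_upwards [ae_sin_ne_zero] with θ hθ
      have h1 := (tendsto_re_joukowskiCauchy hF hρ hsupp hθ (hH _ (hmem hθ))).sub
        ((Complex.continuous_re.tendsto _).comp (hAlim θ))
      rw [hA] at h1
      simpa using h1
  have h0 : (joukowskiCauchy F m ρ 0 - A.aeval 0).im = 0 := by
    simp [joukowskiCauchy, Polynomial.aeval_def, Polynomial.eval₂_at_zero]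
  have him : ∀ w ∈ ball (0 : ℂ) 1, (joukowskiCauchy F m ρ w).im = (A.aeval w).im := by
    intro w hw
    have := congrArg Complex.im (hconst w hw)
    rw [h0, Complex.sub_im] at this
    exact sub_eq_zero.1 this
  have hval : ∀ θ : ℝ, Real.sin θ < 0 →
      π * F (m + ρ * Real.cos θ) = -(B.eval (Real.cos θ) * Real.sin θ) := by
    intro θ hθ
    have h1 := (Complex.continuous_im.tendsto _).comp
      (tendsto_joukowskiCauchy hF hρ hsupp hθ (hH _ (hmem hθ.ne)))
    have h2 := (Complex.continuous_im.tendsto _).comp (hAlim θ)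
    have h3 := tendsto_nhds_unique_of_eventuallyEq h1 h2 (by
      filter_upwards [Ioo_mem_nhdsLT one_pos] with r hr
      exact him _ (by simp [abs_of_pos hr.1, hr.2]))
    rw [hB] at h3
    rw [← h3]
    simp [← Complex.ofReal_mul]
  refine ⟨Polynomial.C π⁻¹ * B, fun x hx => ?_⟩
  have hsin : 0 < √(1 - x ^ 2) := Real.sqrt_pos.2 (by nlinarith [hx.1, hx.2])
  have h := hval (-Real.arccos x) (by rw [Real.sin_neg, Real.sin_arccos]; linarith)
  rw [Real.cos_neg, Real.sin_neg, Real.sin_arccos, Real.cos_arccos hx.1.le hx.2.le] at h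
  rw [Polynomial.eval_mul, Polynomial.eval_C]
  have := pi_ne_zero
  field_simp
  linarith

/-- (c) ⇒ (a): if the Hilbert transform of a continuous `F` supported in `[a,b]` is a
polynomial on `(a,b)`, then `√((b-t)(t-a)) F(t)` is a polynomial on `(a,b)`. -/
theorem stmt8 (a b : ℝ) (hab : a < b) (F : ℝ → ℝ) (hF : Continuous F)
    (hsupp : Function.support F ⊆ Set.Icc a b)
    (P : Polynomial ℝ) (hH : ∀ t ∈ Set.Ioo a b, HilbertAt F t (P.eval t)) :
    ∃ Q : Polynomial ℝ, ∀ t ∈ Set.Ioo a b,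
      Real.sqrt ((b - t) * (t - a)) * F t = Q.eval t := by
  set m := (a + b) / 2 with hm
  set ρ := (b - a) / 2 with hr
  have hρ : 0 < ρ := by linarith
  have ha : m - ρ = a := by ring
  have hb : m + ρ = b := by ring
  obtain ⟨B, hB⟩ := exists_polynomial_eq_sqrt_mul hF (m := m) hρ (by rwa [ha, hb]) (P := P)
    (by rwa [ha, hb])
  refine ⟨(Polynomial.C ρ * (1 - Polynomial.X ^ 2) * B).comp
    (Polynomial.C ρ⁻¹ * (Polynomial.X - Polynomial.C m)), fun t ht => ?_⟩
  set x := ρ⁻¹ * (t - m) with hx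
  have hxt : t = m + ρ * x := by
    rw [hx]
    field_simp
    ring
  have hx1 : x ∈ Ioo (-1 : ℝ) 1 := by
    constructor
    · nlinarith [ht.1]
    · nlinarith [ht.2]
  have hnn : 0 ≤ 1 - x ^ 2 := by nlinarith [hx1.1, hx1.2]
  have hprod : (b - t) * (t - a) = ρ ^ 2 * (1 - x ^ 2) := by
    rw [hxt, ← ha, ← hb]
    ring
  have hFt : F t = √(1 - x ^ 2) * B.eval x := by
    rw [← hB x hx1, ← hxt]
  rw [hprod, Real.sqrt_mul (sq_nonneg ρ), Real.sqrt_sq hρ.le, hFt, Polynomial.eval_comp]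
  simp only [Polynomial.eval_mul, Polynomial.eval_sub, Polynomial.eval_C, Polynomial.eval_X,
    Polynomial.eval_pow, Polynomial.eval_one]
  linear_combination (ρ * B.eval x) * Real.mul_self_sqrt hnn

end
end

section
/- Let a < b be real numbers and let F : ℝ → ℝ be a continuous function supported in [a,b]. If there is a real polynomial R such that F(t) = √((b−t)(t−a)) · R(t) for all t ∈ (a,b), then there is a real polynomial P such that the Hilbert transform 𝓗F(t) = (1/π) p.v. ∫_a^b F(s)/(t−s) ds equals P(t) for all t ∈ (a,b). -/
open MeasureTheory Real Filter Topology Metric Set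
open scoped RealInnerProductSpace

noncomputable section

/-- The semicircle density of centre `c` and radius `r`, extended by zero. -/
def semicircle (c r s : ℝ) : ℝ := √(r ^ 2 - (s - c) ^ 2)

lemma continuous_semicircle (c r : ℝ) : Continuous (semicircle c r) := by
  unfold semicircle; fun_prop

lemma semicircle_eq_zero {c r s : ℝ} (hr : 0 ≤ r) (hs : s ∉ Icc (c - r) (c + r)) :
    semicircle c r s = 0 := by
  apply Real.sqrt_eq_zero_of_nonpos
  by_contra! h
  have := abs_lt_of_sq_lt_sq' (show (s - c) ^ 2 < r ^ 2 by linarith) hr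
  exact hs ⟨by linarith [this.1], by linarith [this.2]⟩

lemma integrable_semicircle_mul {c r : ℝ} (hr : 0 ≤ r) {f : ℝ → ℝ} (hf : Continuous f) :
    Integrable (fun s => semicircle c r s * f s) := by
  apply ((continuous_semicircle c r).mul hf).integrable_of_hasCompactSupport
  refine HasCompactSupport.intro (isCompact_Icc (a := c - r) (b := c + r)) fun s hs => ?_
  simp [semicircle_eq_zero hr hs]

lemma measurableSet_truncation (t ε : ℝ) : MeasurableSet {s : ℝ | ε ≤ |t - s|} :=
  (isClosed_le continuous_const (by fun_prop)).measurableSet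

lemma MeasureTheory.Integrable.integrableOn_div_sub {f : ℝ → ℝ} (hf : Integrable f) (t : ℝ)
    {ε : ℝ} (hε : 0 < ε) : IntegrableOn (fun s => f s / (t - s)) {s : ℝ | ε ≤ |t - s|} := by
  simp only [div_eq_mul_inv]
  refine hf.integrableOn.mul_bdd (c := ε⁻¹) (by fun_prop) ?_
  filter_upwards [ae_restrict_mem (measurableSet_truncation t ε)] with s hs
  rw [norm_inv, Real.norm_eq_abs]
  exact inv_anti₀ hε hs

lemma tendsto_integral_truncation {f : ℝ → ℝ} (hf : Integrable f) (t : ℝ) :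
    Tendsto (fun ε : ℝ => ∫ s in {s : ℝ | ε ≤ |t - s|}, f s) (𝓝[>] 0) (𝓝 (∫ s, f s)) := by
  simp only [← integral_indicator (measurableSet_truncation t _)]
  refine tendsto_integral_filter_of_dominated_convergence (fun s => ‖f s‖)
    (Eventually.of_forall fun ε => hf.1.indicator (measurableSet_truncation t ε))
    (Eventually.of_forall fun ε => ae_of_all _ fun s => norm_indicator_le_norm_self f s)
    hf.norm ?_
  filter_upwards [compl_mem_ae_iff.2 (measure_singleton t)] with s hs
  refine tendsto_const_nhds.congr' ?_
  have hpos : 0 < |t - s| := abs_pos.2 (sub_ne_zero.2 (Ne.symm hs))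
  filter_upwards [nhdsWithin_le_nhds (Iio_mem_nhds hpos)] with ε hε
  exact (indicator_of_mem (show s ∈ {s : ℝ | ε ≤ |t - s|} from (mem_Iio.1 hε).le) f).symm

lemma HilbertAt.add {f g : ℝ → ℝ} {t L M : ℝ} (hf : HilbertAt f t L) (hg : HilbertAt g t M)
    (hfi : Integrable f) (hgi : Integrable g) : HilbertAt (fun s => f s + g s) t (L + M) := by
  refine (Tendsto.add hf hg).congr' ?_
  filter_upwards [self_mem_nhdsWithin] with ε hε
  simp only [add_div]
  rw [integral_add (hfi.integrableOn_div_sub t hε) (hgi.integrableOn_div_sub t hε), mul_add]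

lemma HilbertAt.const_mul {f : ℝ → ℝ} {t L : ℝ} (hf : HilbertAt f t L) (k : ℝ) :
    HilbertAt (fun s => k * f s) t (k * L) := by
  refine (Tendsto.const_mul k hf).congr fun ε => ?_
  simp only [mul_div_assoc, integral_const_mul]
  ring

lemma HilbertAt.mul_id {f : ℝ → ℝ} {t L : ℝ} (hf : HilbertAt f t L) (hfi : Integrable f) :
    HilbertAt (fun s => f s * s) t (t * L - (1 / π) * ∫ s, f s) := by
  refine ((Tendsto.const_mul t hf).sub
    ((tendsto_integral_truncation hfi t).const_mul (1 / π))).congr' ?_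
  filter_upwards [self_mem_nhdsWithin] with ε hε
  have h : ∫ s in {s : ℝ | ε ≤ |t - s|}, f s * s / (t - s)
      = ∫ s in {s : ℝ | ε ≤ |t - s|}, (t * (f s / (t - s)) - f s) := by
    refine setIntegral_congr_fun (measurableSet_truncation t ε) fun s hs => ?_
    have : t - s ≠ 0 := abs_pos.1 (lt_of_lt_of_le hε hs)
    field_simp
    ring
  rw [h, integral_sub ((hfi.integrableOn_div_sub t hε).const_mul t) hfi.integrableOn,
    integral_const_mul]
  ring

/-- The part of a primitive of `s ↦ semicircle c r s / (t - s)` that is continuous at `t`. -/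
def semicirclePrimitive (c r t s : ℝ) : ℝ :=
  semicircle c r t * Real.log (r ^ 2 - (t - c) * (s - c) + semicircle c r t * semicircle c r s)
    + (t - c) * Real.arcsin ((s - c) / r) - semicircle c r s

lemma semicirclePrimitive_log_arg_pos {c r t s : ℝ} (hr : 0 < r) (ht : t ∈ Ioo (c - r) (c + r))
    (hs : s ∈ Icc (c - r) (c + r)) :
    0 < r ^ 2 - (t - c) * (s - c) + semicircle c r t * semicircle c r s := by
  have h1 : 0 ≤ semicircle c r t * semicircle c r s :=
    mul_nonneg (Real.sqrt_nonneg _) (Real.sqrt_nonneg _)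
  have h2 : |t - c| < r := abs_lt.2 ⟨by linarith [ht.1], by linarith [ht.2]⟩
  have h3 : |s - c| ≤ r := abs_le.2 ⟨by linarith [hs.1], by linarith [hs.2]⟩
  have h4 : (t - c) * (s - c) ≤ |t - c| * |s - c| := (le_abs_self _).trans (abs_mul _ _).le
  nlinarith [abs_nonneg (t - c), abs_nonneg (s - c)]

lemma continuousOn_semicirclePrimitive {c r t : ℝ} (hr : 0 < r) (ht : t ∈ Ioo (c - r) (c + r)) :
    ContinuousOn (semicirclePrimitive c r t) (Icc (c - r) (c + r)) := by
  have hg := continuous_semicircle c r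
  unfold semicirclePrimitive
  refine ((continuousOn_const.mul (ContinuousOn.log (by fun_prop) fun s hs =>
    (semicirclePrimitive_log_arg_pos hr ht hs).ne')).add ?_).sub hg.continuousOn
  exact (continuous_const.mul (Real.continuous_arcsin.comp (by fun_prop))).continuousOn

lemma hasDerivAt_semicirclePrimitive_sub_log {c r t s : ℝ} (hr : 0 < r)
    (ht : t ∈ Ioo (c - r) (c + r)) (hs : s ∈ Ioo (c - r) (c + r)) (hst : s ≠ t) :
    HasDerivAt (fun s => semicirclePrimitive c r t s - semicircle c r t * Real.log (t - s))
      (semicircle c r s / (t - s)) s := by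
  have hN := semicirclePrimitive_log_arg_pos hr ht (Ioo_subset_Icc_self hs)
  have hpos : ∀ x ∈ Ioo (c - r) (c + r), 0 < r ^ 2 - (x - c) ^ 2 := fun x hx => by
    nlinarith [hx.1, hx.2]
  have hgs : 0 < semicircle c r s := Real.sqrt_pos.2 (hpos s hs)
  have hgs2 : semicircle c r s ^ 2 = r ^ 2 - (s - c) ^ 2 := Real.sq_sqrt (hpos s hs).le
  have hgt2 : semicircle c r t ^ 2 = r ^ 2 - (t - c) ^ 2 := Real.sq_sqrt (hpos t ht).le
  have hts : t - s ≠ 0 := sub_ne_zero.2 hst.symm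
  have hid : HasDerivAt (fun s => s - c) 1 s := (hasDerivAt_id s).sub_const c
  have hg : HasDerivAt (semicircle c r) (-(s - c) / semicircle c r s) s := by
    have := ((hid.pow 2).const_sub (r ^ 2)).sqrt (hpos s hs).ne'
    refine HasDerivAt.congr_deriv (f := semicircle c r) this ?_
    change _ / (2 * semicircle c r s) = _
    simp only [Nat.cast_ofNat]
    field_simp
    ring
  have harcsin : HasDerivAt (fun s => Real.arcsin ((s - c) / r)) (1 / semicircle c r s) s := by
    have h1 : (s - c) / r ≠ -1 := by
      rw [Ne, div_eq_iff hr.ne']; intro h; linarith [hs.1]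
    have h2 : (s - c) / r ≠ 1 := by
      rw [Ne, div_eq_iff hr.ne']; intro h; linarith [hs.2]
    have := (Real.hasDerivAt_arcsin h1 h2).comp s (hid.div_const r)
    refine this.congr_deriv ?_
    have h3 : √(1 - ((s - c) / r) ^ 2) = semicircle c r s / r := by
      rw [show 1 - ((s - c) / r) ^ 2 = (r ^ 2 - (s - c) ^ 2) / r ^ 2 by field_simp,
        Real.sqrt_div (hpos s hs).le, Real.sqrt_sq hr.le, semicircle]
    rw [h3]
    field_simp
  have hlog := ((((hid.const_mul (t - c)).const_sub (r ^ 2)).add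
    (hg.const_mul (semicircle c r t))).log hN.ne').const_mul (semicircle c r t)
  have hlog' := (((hasDerivAt_id s).const_sub t).log hts).const_mul (semicircle c r t)
  refine (((hlog.add (harcsin.const_mul (t - c))).sub hg).sub hlog').congr_deriv ?_
  simp only [Pi.add_apply, id]
  generalize semicircle c r s = g at *
  generalize semicircle c r t = w at *
  have hN' := hN.ne'
  have key : w * ((-((t - c) * 1) + w * (-(s - c) / g)) / (r ^ 2 - (t - c) * (s - c) + w * g))
      = w ^ 2 / (g * (t - s)) - w / (t - s) := by
    field_simp
    linear_combination w ^ 2 * hgs2 - w * g * hgt2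
  rw [key, hgt2]
  field_simp
  linear_combination -hgs2

lemma integral_semicircle_div_sub {c r t p q : ℝ} (hr : 0 < r) (ht : t ∈ Ioo (c - r) (c + r))
    (hp : c - r ≤ p) (hq : q ≤ c + r) (hpq : p ≤ q) (htpq : t ∉ Icc p q) :
    ∫ s in p..q, semicircle c r s / (t - s) =
      (semicirclePrimitive c r t q - semicircle c r t * Real.log (t - q)) -
      (semicirclePrimitive c r t p - semicircle c r t * Real.log (t - p)) := by
  have hne : ∀ s ∈ Icc p q, t - s ≠ 0 := fun s hs h => htpq (sub_eq_zero.1 h ▸ hs)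
  refine intervalIntegral.integral_eq_sub_of_hasDerivAt_of_le hpq
    (f := fun s => semicirclePrimitive c r t s - semicircle c r t * Real.log (t - s)) ?_ ?_ ?_
  · exact ((continuousOn_semicirclePrimitive hr ht).mono (Icc_subset_Icc hp hq)).sub
      (continuousOn_const.mul (ContinuousOn.log (by fun_prop) hne))
  · intro s hs
    exact hasDerivAt_semicirclePrimitive_sub_log hr ht (Ioo_subset_Ioo hp hq hs)
      (sub_ne_zero.1 (hne s (Ioo_subset_Icc_self hs))).symm
  · apply ContinuousOn.intervalIntegrable
    rw [uIcc_of_le hpq]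
    exact (continuous_semicircle c r).continuousOn.div (by fun_prop) hne

lemma integral_truncation_semicircle {c r t ε : ℝ} (hr : 0 < r) (ht : t ∈ Ioo (c - r) (c + r))
    (hε : 0 < ε) (hl : ε < t - (c - r)) (hu : ε < c + r - t) :
    ∫ s in {s : ℝ | ε ≤ |t - s|}, semicircle c r s / (t - s) =
      semicirclePrimitive c r t (t - ε) - semicirclePrimitive c r t (t + ε) + π * (t - c) := by
  have hsub : Icc (c - r) (t - ε) ∪ Icc (t + ε) (c + r) ⊆ {s : ℝ | ε ≤ |t - s|} := by
    rintro s (hs | hs)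
    · exact le_abs.2 (Or.inl (le_sub_comm.1 hs.2))
    · exact le_abs.2 (Or.inr (show ε ≤ -(t - s) by linarith [hs.1]))
  have hdisj : Disjoint (Icc (c - r) (t - ε)) (Icc (t + ε) (c + r)) :=
    Set.disjoint_left.2 fun s hs hs' => by linarith [hs.2, hs'.1]
  have hint : IntegrableOn (fun s => semicircle c r s / (t - s)) {s : ℝ | ε ≤ |t - s|} := by
    have := integrable_semicircle_mul (c := c) hr.le continuous_one
    exact Integrable.integrableOn_div_sub (by simpa using this) t hε
  rw [setIntegral_eq_of_subset_of_forall_sdiff_eq_zero (measurableSet_truncation t ε) hsub,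
    setIntegral_union hdisj measurableSet_Icc
      (hint.mono_set (subset_union_left.trans hsub)) (hint.mono_set (subset_union_right.trans hsub)),
    integral_Icc_eq_integral_Ioc, integral_Icc_eq_integral_Ioc,
    ← intervalIntegral.integral_of_le (by linarith),
    ← intervalIntegral.integral_of_le (by linarith),
    integral_semicircle_div_sub hr ht le_rfl (by linarith) (by linarith)
      (fun h => by linarith [h.2]),
    integral_semicircle_div_sub hr ht (by linarith) le_rfl (by linarith)
      (fun h => by linarith [h.1])]
  · have h1 : semicircle c r (c - r) = 0 := by simp [semicircle]
    have h2 : semicircle c r (c + r) = 0 := by simp [semicircle]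
    have e1 : t - (t - ε) = ε := by ring
    have e2 : t - (t + ε) = -ε := by ring
    have e3 : r ^ 2 - (t - c) * (c - r - c) = r * (t - (c - r)) := by ring
    have e4 : r ^ 2 - (t - c) * (c + r - c) = r * -(t - (c + r)) := by ring
    have e5 : (c - r - c) / r = -1 := by field_simp; ring
    have e6 : (c + r - c) / r = 1 := by field_simp; ring
    have hlm : t - (c - r) ≠ 0 := by linarith
    have hlp : -(t - (c + r)) ≠ 0 := by linarith
    have hend : semicirclePrimitive c r t (c + r) - semicircle c r t * Real.log (t - (c + r)) -
        (semicirclePrimitive c r t (c - r) - semicircle c r t * Real.log (t - (c - r)))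
        = π * (t - c) := by
      simp only [semicirclePrimitive, h1, h2, mul_zero, add_zero, e3, e4, e5, e6,
        Real.arcsin_neg, Real.arcsin_one]
      rw [Real.log_mul hr.ne' hlm, Real.log_mul hr.ne' hlp, Real.log_neg_eq_log]
      ring
    rw [e1, e2, Real.log_neg_eq_log]
    linear_combination hend
  · rintro s ⟨hs, hs'⟩
    rw [semicircle_eq_zero hr.le, zero_div]
    intro h
    rcases le_abs.1 (show ε ≤ |t - s| from hs) with h3 | h3
    · exact hs' (Or.inl ⟨h.1, by linarith⟩)
    · exact hs' (Or.inr ⟨by linarith, h.2⟩)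

lemma hilbertAt_semicircle {c r t : ℝ} (hr : 0 < r) (ht : t ∈ Ioo (c - r) (c + r)) :
    HilbertAt (semicircle c r) t (t - c) := by
  have hcont : ContinuousAt (semicirclePrimitive c r t) t :=
    (continuousOn_semicirclePrimitive hr ht).continuousAt (Icc_mem_nhds ht.1 ht.2)
  have hm : Tendsto (fun ε : ℝ => semicirclePrimitive c r t (t - ε)) (𝓝[>] 0)
      (𝓝 (semicirclePrimitive c r t t)) := by
    refine (Tendsto.comp hcont ?_).mono_left nhdsWithin_le_nhds
    exact Continuous.tendsto' (by fun_prop) _ _ (by simp)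
  have hp : Tendsto (fun ε : ℝ => semicirclePrimitive c r t (t + ε)) (𝓝[>] 0)
      (𝓝 (semicirclePrimitive c r t t)) := by
    refine (Tendsto.comp hcont ?_).mono_left nhdsWithin_le_nhds
    exact Continuous.tendsto' (by fun_prop) _ _ (by simp)
  have h := ((hm.sub hp).add_const (π * (t - c))).const_mul (1 / π)
  have hlim : 1 / π * (semicirclePrimitive c r t t - semicirclePrimitive c r t t + π * (t - c))
      = t - c := by
    field_simp
    ring
  rw [hlim] at h
  refine h.congr' ?_
  filter_upwards [self_mem_nhdsWithin, nhdsWithin_le_nhds (Iio_mem_nhds (sub_pos.2 ht.1)),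
    nhdsWithin_le_nhds (Iio_mem_nhds (sub_pos.2 ht.2))] with ε hε hl hu
  rw [integral_truncation_semicircle hr ht hε hl hu]

lemma exists_polynomial_hilbertAt_semicircle_mul {c r : ℝ} (hr : 0 < r) (R : Polynomial ℝ) :
    ∃ P : Polynomial ℝ, ∀ t ∈ Ioo (c - r) (c + r),
      HilbertAt (fun s => semicircle c r s * R.eval s) t (P.eval t) := by
  induction R using Polynomial.induction_on with
  | C k =>
    refine ⟨Polynomial.C k * (Polynomial.X - Polynomial.C c), fun t ht => ?_⟩
    simpa [mul_comm] using (hilbertAt_semicircle hr ht).const_mul k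
  | add p q hp hq =>
    obtain ⟨P, hP⟩ := hp
    obtain ⟨Q, hQ⟩ := hq
    refine ⟨P + Q, fun t ht => ?_⟩
    simpa [mul_add] using (hP t ht).add (hQ t ht)
      (integrable_semicircle_mul hr.le p.continuous) (integrable_semicircle_mul hr.le q.continuous)
  | monomial n k hp =>
    obtain ⟨P, hP⟩ := hp
    refine ⟨Polynomial.X * P - Polynomial.C ((1 / π) *
      ∫ s, semicircle c r s * (Polynomial.C k * Polynomial.X ^ n : Polynomial ℝ).eval s),
      fun t ht => ?_⟩
    have h := (hP t ht).mul_id (integrable_semicircle_mul hr.le (Polynomial.continuous _))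
    have e : (fun s => semicircle c r s *
        (Polynomial.C k * Polynomial.X ^ (n + 1) : Polynomial ℝ).eval s) = fun s =>
        semicircle c r s * (Polynomial.C k * Polynomial.X ^ n : Polynomial ℝ).eval s * s := by
      funext s
      simp only [Polynomial.eval_mul, Polynomial.eval_C, Polynomial.eval_pow, Polynomial.eval_X]
      ring
    rw [e, Polynomial.eval_sub, Polynomial.eval_mul, Polynomial.eval_X, Polynomial.eval_C]
    exact h

/-- (b) ⇒ (c): if `F(t) = √((b-t)(t-a)) R(t)` on `(a,b)` for a polynomial `R`, for a
continuous `F` supported in `[a,b]`, then the Hilbert transform of `F` is a polynomial on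
`(a,b)`. -/
theorem stmt9 (a b : ℝ) (hab : a < b) (F : ℝ → ℝ) (hF : Continuous F)
    (hsupp : Function.support F ⊆ Set.Icc a b)
    (R : Polynomial ℝ) (hR : ∀ t ∈ Set.Ioo a b,
      F t = Real.sqrt ((b - t) * (t - a)) * R.eval t) :
    ∃ P : Polynomial ℝ, ∀ t ∈ Set.Ioo a b, HilbertAt F t (P.eval t) := by
  have ha : (a + b) / 2 - (b - a) / 2 = a := by ring
  have hb : (a + b) / 2 + (b - a) / 2 = b := by ring
  have hr : 0 < (b - a) / 2 := by linarith
  have hFR : F = fun s => semicircle ((a + b) / 2) ((b - a) / 2) s * R.eval s := by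
    refine Continuous.ext_on (s := {a, b}ᶜ) ((Set.toFinite {a, b}).countable.dense_compl ℝ) hF
      ((continuous_semicircle _ _).mul R.continuous) fun s hs => ?_
    by_cases hI : s ∈ Icc a b
    · have hne : s ≠ a ∧ s ≠ b := by simpa using hs
      rw [hR s ⟨lt_of_le_of_ne hI.1 hne.1.symm, lt_of_le_of_ne hI.2 hne.2⟩]
      simp only [semicircle]
      congr 2
      ring
    · rw [semicircle_eq_zero hr.le (by rwa [ha, hb]), zero_mul]
      exact Function.notMem_support.1 fun h => hI (hsupp h)
  have h := exists_polynomial_hilbertAt_semicircle_mul (c := (a + b) / 2) hr R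
  rwa [ha, hb, ← hFR] at h

end
end
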